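/- Let T > 0. Let φ : ℝ → ℝ be an increasing homeomorphism of ℝ onto ℝ with φ(0) = 0 satisfying the upper σ-condition at zero: limsup_{s→0⁺} |φ(σ s)|/φ(s) < +∞ for every σ ∈ ℝ with |σ| > 1, and the lower σ-condition at infinity: limsup_{s→±∞} φ(σ s)/φ(s) < +∞ for every σ > 1. Let a : ℝ → ℝ be a locally integrable T-periodic function satisfying (a#) and (a*). Let g : [0,+∞) → [0,+∞) be continuous, regularly oscillating at zero, satisfy (g*), lim_{s→0⁺} g(s)/φ(s) = 0, and lim_{s→±∞} g(|s|)/|φ(s)| = +∞. Then for every λ > 0, the equation (φ(u'))' + λ a(t) g(u) = 0 has at least one T-periodic solution u with u(t) > 0 for all t ∈ ℝ. -/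

import Mathlib

open MeasureTheory Set Filter

noncomputable section

/-- `u` is a `T`-periodic solution of `(φ(u'))' = F t (u t)`: `u` is `T`-periodic,
of class `C¹` (with continuous derivative `du`), and `φ ∘ u'` is absolutely
continuous with derivative `F t (u t)` a.e. (expressed in integral form). -/
def IsPhiLapSol (T : ℝ) (φ : ℝ → ℝ) (F : ℝ → ℝ → ℝ) (u : ℝ → ℝ) : Prop :=
  Function.Periodic u T ∧
  ∃ du : ℝ → ℝ, Continuous du ∧ (∀ t : ℝ, HasDerivAt u (du t) t) ∧
    (∀ t₁ t₂ : ℝ, IntervalIntegrable (fun s => F s (u s)) volume t₁ t₂) ∧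
    ∀ t : ℝ, φ (du t) = φ (du 0) + ∫ s in (0:ℝ)..t, F s (u s)

/-- Condition (a*): there are `N + 1 ≥ 1` pairwise disjoint closed intervals
`[σ n, τ n]` contained in a period, on which `a > 0` a.e., while `a ≤ 0` a.e.
on the rest of the period. -/
def SignChanging (T : ℝ) (a : ℝ → ℝ) (N : ℕ) (σ τ : Fin (N + 1) → ℝ) : Prop :=
  (∀ n, σ n < τ n) ∧
  (∀ m n : Fin (N + 1), m < n → τ m < σ n) ∧
  (∀ n, τ n < σ 0 + T) ∧
  (∀ n, ∀ᵐ t ∂volume, t ∈ Set.Icc (σ n) (τ n) → 0 < a t) ∧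
  (∀ᵐ t ∂volume, t ∈ Set.Ico (σ 0) (σ 0 + T) \ (⋃ n, Set.Icc (σ n) (τ n)) → a t ≤ 0)

/-- `g` is regularly oscillating at zero: `g (ω s) / g s → 1` as `s → 0⁺` and `ω → 1`. -/
def RegOscZero (g : ℝ → ℝ) : Prop :=
  Tendsto (fun p : ℝ × ℝ => g (p.1 * p.2) / g p.2)
    ((nhds 1) ×ˢ (nhdsWithin 0 (Set.Ioi 0))) (nhds 1)

/-- `t ↦ det (1 + t A)` is a polynomial function of degree at most the dimension. -/
lemma exists_polynomial_eval_eq_det_one_add_smul {n : ℕ}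
    (A : EuclideanSpace ℝ (Fin n) →ₗ[ℝ] EuclideanSpace ℝ (Fin n)) :
    ∃ P : Polynomial ℝ, P.natDegree ≤ n ∧ ∀ t : ℝ, P.eval t = LinearMap.det (1 + t • A) := by
  classical
  set b := (EuclideanSpace.basisFun (Fin n) ℝ).toBasis
  set M := LinearMap.toMatrix b b A
  refine ⟨Matrix.det ((Polynomial.X : Polynomial ℝ) • M.map Polynomial.C
    + (1 : Matrix (Fin n) (Fin n) ℝ).map Polynomial.C), ?_, fun t => ?_⟩
  · simpa using Polynomial.natDegree_det_X_add_C_le M 1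
  · rw [← LinearMap.det_toMatrix b, ← Polynomial.coe_evalRingHom, RingHom.map_det]
    congr 1
    ext i j
    by_cases hij : i = j <;>
      simp [M, LinearMap.toMatrix_one, Matrix.add_apply, hij] <;> ring

/-- If an integrand depends polynomially (of bounded degree) on a parameter and its integral is
constant for small parameters, then it is constant for all parameters. -/
lemma integral_eq_of_polynomial_of_small {X : Type*} [MeasurableSpace X] {μ : Measure X} {n : ℕ}
    {d : ℝ → X → ℝ} (hP : ∀ x, ∃ P : Polynomial ℝ, P.natDegree ≤ n ∧ ∀ t, P.eval t = d t x)
    {c t₀ : ℝ} (ht₀ : 0 < t₀) (hint : ∀ t, Integrable (d t) μ)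
    (hc : ∀ t ∈ Ioo 0 t₀, ∫ x, d t x ∂μ = c) (t : ℝ) : ∫ x, d t x ∂μ = c := by
  classical
  set s := Finset.range (n + 1)
  set v : ℕ → ℝ := fun j => t₀ * ((j + 1) / (n + 2))
  have hv : Set.InjOn v s := by
    intro i _ j _ hij
    have h2 : (n : ℝ) + 2 ≠ 0 := by positivity
    simp only [v] at hij
    field_simp at hij
    exact_mod_cast add_right_cancel hij
  have hvm : ∀ j ∈ s, v j ∈ Ioo 0 t₀ := by
    intro j hj
    have hj' : (j : ℝ) < n + 1 := by exact_mod_cast Finset.mem_range.1 hj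
    refine ⟨by positivity, ?_⟩
    have : ((j : ℝ) + 1) / (n + 2) < 1 := by rw [div_lt_one (by positivity)]; linarith
    simp only [v]
    nlinarith
  have hd : ∀ x, d t x = ∑ j ∈ s, d (v j) x * (Lagrange.basis s v j).eval t := by
    intro x
    obtain ⟨P, hPn, hPe⟩ := hP x
    have hdeg : P.degree < s.card := by
      rw [Finset.card_range]
      exact lt_of_le_of_lt Polynomial.degree_le_natDegree (by exact_mod_cast Nat.lt_succ_of_le hPn)
    have h := congrArg (Polynomial.eval t) (Lagrange.eq_interpolate hv hdeg)
    rw [hPe, Lagrange.interpolate_apply, Polynomial.eval_finsetSum] at h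
    simpa [hPe] using h
  simp_rw [hd]
  rw [integral_finsetSum _ (fun j _ => (hint _).mul_const _)]
  have h1 : ∑ j ∈ s, (Lagrange.basis s v j).eval t = 1 := by
    rw [← Polynomial.eval_finsetSum, Lagrange.sum_basis hv ⟨0, by simp [s]⟩, Polynomial.eval_one]
  calc _ = ∑ j ∈ s, c * (Lagrange.basis s v j).eval t := by
        refine Finset.sum_congr rfl fun j hj => ?_
        rw [integral_mul_const, hc _ (hvm j hj)]
    _ = c := by rw [← Finset.mul_sum, h1, mul_one]

/-- A Lipschitz function on a ball vanishing on the boundary sphere is Lipschitz when extended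
by zero. -/
lemma lipschitzWith_indicator_closedBall {E F : Type*} [NormedAddCommGroup E] [NormedSpace ℝ E]
    [NormedAddCommGroup F] {g : E → F} {ρ : ℝ} {L : NNReal}
    (hg : LipschitzOnWith L g (Metric.closedBall 0 ρ)) (h0 : ∀ x, ‖x‖ = ρ → g x = 0) :
    LipschitzWith L ((Metric.closedBall (0 : E) ρ).indicator g) := by
  classical
  have key : ∀ x y : E, ‖x‖ ≤ ρ → ¬ ‖y‖ ≤ ρ → ‖g x‖ ≤ L * ‖x - y‖ := by
    intro x y hx hy
    have hcont : ContinuousOn (fun s : ℝ => ‖x + s • (y - x)‖) (Icc 0 1) := by fun_prop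
    obtain ⟨s, hs, hs'⟩ := intermediate_value_Icc (zero_le_one' ℝ) hcont
      (show ρ ∈ Icc _ _ by simpa using ⟨hx, (not_le.1 hy).le⟩)
    have hz := hg.dist_le_mul x (by simpa using hx) (x + s • (y - x)) (by simp [hs'])
    rw [h0 _ hs', dist_zero_right, dist_eq_norm] at hz
    refine hz.trans (mul_le_mul_of_nonneg_left ?_ L.2)
    rw [sub_add_cancel_left, norm_neg, norm_smul, norm_sub_rev x y, Real.norm_of_nonneg hs.1]
    exact mul_le_of_le_one_left (norm_nonneg _) hs.2
  refine LipschitzWith.of_dist_le_mul fun x y => ?_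
  by_cases hx : ‖x‖ ≤ ρ <;> by_cases hy : ‖y‖ ≤ ρ <;>
    simp only [Set.indicator, Metric.mem_closedBall, dist_zero_right, hx, hy, if_true, if_false]
  · exact hg.dist_le_mul x (by simpa using hx) y (by simpa using hy)
  · simpa [dist_eq_norm] using key x y hx hy
  · simpa [dist_eq_norm, norm_sub_rev] using key y x hy hx
  · simp; positivity

/-- A linear map of the form `1 + t A` with `t‖A‖ < 1` has positive determinant. -/
lemma det_one_add_smul_pos {n : ℕ}
    (A : EuclideanSpace ℝ (Fin n) →L[ℝ] EuclideanSpace ℝ (Fin n)) {L t : ℝ} (hA : ‖A‖ ≤ L)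
    (ht : 0 ≤ t) (htL : t * L < 1) :
    0 < LinearMap.det (1 + t • (A : EuclideanSpace ℝ (Fin n) →ₗ[ℝ] EuclideanSpace ℝ (Fin n))) := by
  obtain ⟨P, -, hP⟩ := exists_polynomial_eval_eq_det_one_add_smul
    (A : EuclideanSpace ℝ (Fin n) →ₗ[ℝ] EuclideanSpace ℝ (Fin n))
  have hne : ∀ s ∈ Icc 0 t, P.eval s ≠ 0 := by
    intro s hs h0
    rw [hP] at h0
    obtain ⟨v, hv, hv0⟩ := (Submodule.ne_bot_iff _).1 (LinearMap.bot_lt_ker_of_det_eq_zero h0).ne'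
    have hv' : v = -(s • A v) := by
      have : v + s • A v = 0 := by simpa using hv
      exact eq_neg_of_add_eq_zero_left this
    have h1 : ‖v‖ ≤ s * (L * ‖v‖) := by
      calc ‖v‖ = ‖s • A v‖ := by rw [← norm_neg (s • A v), ← hv']
        _ = s * ‖A v‖ := by rw [norm_smul, Real.norm_of_nonneg hs.1]
        _ ≤ s * (L * ‖v‖) := mul_le_mul_of_nonneg_left
            ((A.le_opNorm v).trans (mul_le_mul_of_nonneg_right hA (norm_nonneg v))) hs.1
    have hvp : 0 < ‖v‖ := norm_pos_iff.2 hv0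
    have hL : 0 ≤ L := (norm_nonneg A).trans hA
    have : s * L ≤ t * L := mul_le_mul_of_nonneg_right hs.2 hL
    nlinarith
  by_contra hcon
  rw [← hP] at hcon
  have h0 : P.eval 0 = 1 := by rw [hP]; simp
  obtain ⟨s, hs, hs'⟩ := intermediate_value_Icc' ht P.continuous.continuousOn
    (show (0 : ℝ) ∈ Icc (P.eval t) (P.eval 0) from ⟨not_lt.1 hcon, by rw [h0]; norm_num⟩)
  exact hne s hs hs'

/-- There is no `C¹` retraction of a ball onto its boundary sphere. -/
theorem no_smooth_retraction {n : ℕ} {ρ : ℝ} (hρ : 0 < ρ)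
    {r : EuclideanSpace ℝ (Fin n) → EuclideanSpace ℝ (Fin n)} (hr : ContDiff ℝ 1 r)
    (hnorm : ∀ x, ‖r x‖ = ρ) (hid : ∀ x, ‖x‖ = ρ → r x = x) : False := by
  set B := Metric.closedBall (0 : EuclideanSpace ℝ (Fin n)) ρ
  set g : EuclideanSpace ℝ (Fin n) → EuclideanSpace ℝ (Fin n) := fun x => r x - x
  have hgc : ContDiff ℝ 1 g := hr.sub contDiff_id
  have hgd : Differentiable ℝ g := hgc.differentiable one_ne_zero
  have hDc : Continuous (fderiv ℝ g) := hgc.continuous_fderiv one_ne_zero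
  have hBc : IsCompact B := isCompact_closedBall _ _
  obtain ⟨L₀, hL₀⟩ := hBc.exists_bound_of_continuousOn hDc.continuousOn
  obtain ⟨L, hL1, hL2⟩ : ∃ L : NNReal, 1 ≤ (L : ℝ) ∧ L₀ ≤ L :=
    ⟨Real.toNNReal (max 1 L₀), by simp⟩
  have hL : ∀ x ∈ B, ‖fderiv ℝ g x‖ ≤ L := fun x hx =>
    (hL₀ x hx).trans hL2
  have hLpos : (0 : ℝ) < L := by linarith
  have hlip : LipschitzOnWith L g B :=
    (convex_closedBall _ _).lipschitzOnWith_of_nnnorm_fderiv_le (fun x _ => hgd x)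
      (fun x hx => hL x hx)
  have hlip' := lipschitzWith_indicator_closedBall hlip (fun x hx => by simp [g, hid x hx])
  set ĝ := B.indicator g
  set d : ℝ → EuclideanSpace ℝ (Fin n) → ℝ := fun t x =>
    LinearMap.det (1 + t • (fderiv ℝ g x : EuclideanSpace ℝ (Fin n) →ₗ[ℝ] EuclideanSpace ℝ (Fin n)))
  have hdc : ∀ t, Continuous (d t) := by
    intro t
    have : Continuous fun x =>
        (1 + t • fderiv ℝ g x : EuclideanSpace ℝ (Fin n) →L[ℝ] EuclideanSpace ℝ (Fin n)).det :=
      ContinuousLinearMap.continuous_det.comp (by fun_prop)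
    exact this
  have hint : ∀ t, Integrable (d t) (volume.restrict B) := fun t =>
    (hdc t).continuousOn.integrableOn_compact hBc
  have hsmall : ∀ t ∈ Ioo (0 : ℝ) (1 / L), ∫ x in B, d t x = volume.real B := by
    intro t ht
    have htL : t * L < 1 := by
      have := mul_lt_mul_of_pos_right ht.2 hLpos
      rwa [one_div_mul_cancel hLpos.ne'] at this
    have hf' : ∀ x ∈ B, HasFDerivWithinAt (fun x => x + t • g x)
        (1 + t • fderiv ℝ g x : EuclideanSpace ℝ (Fin n) →L[ℝ] EuclideanSpace ℝ (Fin n)) B x :=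
      fun x _ =>
      ((hasFDerivAt_id x).add ((hgd x).hasFDerivAt.const_smul t)).hasFDerivWithinAt
    have hĝ : ∀ x ∈ B, ĝ x = g x := fun x hx => Set.indicator_of_mem hx g
    have hsub : ∀ x y : EuclideanSpace ℝ (Fin n), ‖t • ĝ x - t • ĝ y‖ ≤ t * L * ‖x - y‖ := by
      intro x y
      rw [← smul_sub, norm_smul, Real.norm_of_nonneg ht.1.le, mul_assoc]
      exact mul_le_mul_of_nonneg_left (by simpa [dist_eq_norm] using hlip'.dist_le_mul x y) ht.1.le
    have hinj : Set.InjOn (fun x => x + t • g x) B := by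
      intro x hx y hy hxy
      simp only at hxy
      rw [← hĝ x hx, ← hĝ y hy] at hxy
      have h1 : x - y = -(t • ĝ x - t • ĝ y) := by
        have := sub_eq_zero.2 hxy
        rw [← sub_eq_zero]; rw [← this]; abel
      have h2 := hsub x y
      rw [← norm_neg (t • ĝ x - t • ĝ y), ← h1] at h2
      by_contra hne
      have : 0 < ‖x - y‖ := norm_pos_iff.2 (sub_ne_zero.2 hne)
      nlinarith
    have himg : (fun x => x + t • g x) '' B = B := by
      apply Set.Subset.antisymm
      · rintro _ ⟨x, hx, rfl⟩
        have h1 : x + t • g x = (1 - t) • x + t • r x := by simp only [g]; module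
        have hx' : ‖x‖ ≤ ρ := by simpa [B] using hx
        have ht1 : t < 1 := by
          nlinarith [ht.1]
        simp only [B, Metric.mem_closedBall, dist_zero_right]
        rw [h1]
        refine (norm_add_le _ _).trans ?_
        rw [norm_smul, norm_smul, hnorm, Real.norm_of_nonneg ht.1.le,
          Real.norm_of_nonneg (by linarith : 0 ≤ 1 - t)]
        nlinarith
      · intro y hy
        have hcon : ContractingWith ⟨t * L, by have := ht.1; positivity⟩
            (fun x => y - t • ĝ x) := by
          refine ⟨by exact_mod_cast htL, LipschitzWith.of_dist_le_mul fun a b => ?_⟩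
          rw [dist_eq_norm, dist_eq_norm, sub_sub_sub_cancel_left, norm_sub_rev]
          exact hsub a b
        have hx := hcon.fixedPoint_isFixedPt
        set x := hcon.fixedPoint _
        have hx' : x + t • ĝ x = y := by
          have : y - t • ĝ x = x := hx
          exact (sub_eq_iff_eq_add.1 this).symm
        have hxB : x ∈ B := by
          by_contra hxB
          have h0 : ĝ x = 0 := Set.indicator_of_notMem hxB g
          rw [h0, smul_zero, add_zero] at hx'
          exact hxB (hx' ▸ hy)
        exact ⟨x, hxB, by simp only; rw [← hĝ x hxB, hx']⟩
    have hcv := integral_image_eq_integral_abs_det_fderiv_smul volume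
      (Metric.isClosed_closedBall.measurableSet : MeasurableSet B) hf' hinj (fun _ => (1 : ℝ))
    rw [himg] at hcv
    simp only [smul_eq_mul, mul_one, integral_const, MeasurableSet.univ,
      measureReal_restrict_apply, univ_inter] at hcv
    rw [hcv]
    refine setIntegral_congr_fun Metric.isClosed_closedBall.measurableSet fun x hx => ?_
    exact (abs_of_pos (det_one_add_smul_pos _ (hL x hx) ht.1.le htL)).symm
  have h1 : ∫ x in B, d 1 x = volume.real B := integral_eq_of_polynomial_of_small (n := n)
    (fun x => exists_polynomial_eval_eq_det_one_add_smul _) (by positivity) hint hsmall 1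
  have h0 : ∀ x, d 1 x = 0 := by
    intro x
    by_contra hne
    have hrd : HasFDerivAt r
        (1 + (1 : ℝ) • fderiv ℝ g x : EuclideanSpace ℝ (Fin n) →L[ℝ] EuclideanSpace ℝ (Fin n)) x := by
      have : r = fun x => x + (1 : ℝ) • g x := by ext1 x; simp [g]
      rw [this]
      exact (hasFDerivAt_id x).add ((hgd x).hasFDerivAt.const_smul (1 : ℝ))
    have hsurj := ((LinearMap.equivOfDetNeZero _ hne).surjective) (r x)
    obtain ⟨v, hv⟩ := hsurj
    have hv' : (1 + (1 : ℝ) • fderiv ℝ g x : EuclideanSpace ℝ (Fin n) →L[ℝ] EuclideanSpace ℝ (Fin n)) v =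
        r x := hv
    have hsq : HasFDerivAt (fun y => ‖r y‖ ^ 2) _ x := hrd.norm_sq
    have hc : (fun y => ‖r y‖ ^ 2) = fun _ => ρ ^ 2 := by ext1 y; rw [hnorm]
    rw [hc] at hsq
    have := congrArg (fun l : EuclideanSpace ℝ (Fin n) →L[ℝ] ℝ => l v)
      (hsq.unique (hasFDerivAt_const _ _))
    simp only [smul_apply, ContinuousLinearMap.comp_apply] at this
    have hv2 : v + fderiv ℝ g x v = r x := by simpa using hv'
    simp [hv2, hnorm, hρ.ne'] at this
  simp only [h0, integral_zero] at h1
  have hpos : 0 < volume.real B :=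
    ENNReal.toReal_pos (Metric.measure_closedBall_pos volume _ hρ).ne' hBc.measure_lt_top.ne
  exact hpos.ne h1

/-- **Brouwer's fixed point theorem** for bounded continuous self-maps of a Euclidean space. -/
theorem exists_fixedPoint_of_continuous_of_bounded {n : ℕ}
    {F : EuclideanSpace ℝ (Fin n) → EuclideanSpace ℝ (Fin n)} (hF : Continuous F) {R : ℝ}
    (hR : ∀ x, ‖F x‖ ≤ R) : ∃ x, F x = x := by
  by_contra! hne
  have hR0 : 0 ≤ R := (norm_nonneg _).trans (hR 0)
  obtain ⟨G, hG, hGF, -⟩ := hF.exists_contDiff_approx 1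
    (show Continuous fun x => min 1 ‖F x - x‖ by fun_prop)
    (fun x => lt_min one_pos (norm_pos_iff.2 (sub_ne_zero.2 (hne x))))
  have hG1 : ∀ x, ‖G x‖ ≤ R + 1 := by
    intro x
    have h := (hGF x).trans_le (min_le_left _ _)
    rw [dist_eq_norm] at h
    have := norm_add_le (G x - F x) (F x)
    rw [sub_add_cancel] at this
    linarith [hR x]
  have hGx : ∀ x, G x ≠ x := by
    intro x hx
    have h := (hGF x).trans_le (min_le_right _ _)
    rw [dist_eq_norm, hx, norm_sub_rev] at h
    exact lt_irrefl _ h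
  let χ : ContDiffBump (0 : EuclideanSpace ℝ (Fin n)) :=
    ⟨R + 2, R + 3, by linarith, by linarith⟩
  set f : EuclideanSpace ℝ (Fin n) → EuclideanSpace ℝ (Fin n) := fun x => x - χ x • G x
  have hf : ContDiff ℝ 1 f := contDiff_id.sub (χ.contDiff.smul hG)
  have hf0 : ∀ x, f x ≠ 0 := by
    intro x hx
    have hx' : x = χ x • G x := sub_eq_zero.1 hx
    rcases le_or_gt ‖x‖ (R + 2) with h | h
    · have h1 : χ x = 1 := χ.one_of_mem_closedBall (by simpa [χ] using h)
      rw [h1, one_smul] at hx'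
      exact hGx x hx'.symm
    · have h2 : ‖x‖ ≤ R + 1 := by
        calc ‖x‖ = ‖χ x • G x‖ := by rw [← hx']
          _ = χ x * ‖G x‖ := by rw [norm_smul, Real.norm_of_nonneg χ.nonneg]
          _ ≤ 1 * ‖G x‖ := mul_le_mul_of_nonneg_right χ.le_one (norm_nonneg _)
          _ ≤ R + 1 := by rw [one_mul]; exact hG1 x
      linarith
  have hρ : 0 < R + 3 := by linarith
  refine no_smooth_retraction hρ (r := fun x => ((R + 3) / ‖f x‖) • f x) ?_ ?_ ?_
  · exact (contDiff_const.div (hf.norm ℝ hf0) fun x => norm_ne_zero_iff.2 (hf0 x)).smul hf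
  · intro x
    have := norm_pos_iff.2 (hf0 x)
    rw [norm_smul, Real.norm_of_nonneg (by positivity), div_mul_cancel₀ _ this.ne']
  · intro x hx
    have h0 : χ x = 0 := χ.zero_of_le_dist (by simp [χ, hx])
    have hfx : f x = x := by simp [f, h0]
    simp only [hfx, hx]
    rw [div_self hρ.ne', one_smul]

/-- **Schauder's fixed point theorem** for continuous self-maps of a normed space with relatively
compact range. -/
theorem exists_fixedPoint_of_range_subset_compact {Z : Type*} [NormedAddCommGroup Z]
    [NormedSpace ℝ Z] {M : Z → Z} (hM : Continuous M) {K : Set Z} (hK : IsCompact K)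
    (hMK : ∀ z, M z ∈ K) : ∃ z, M z = z := by
  have approx : ∀ ε > 0, ∃ z, dist z (M z) ≤ ε := by
    intro ε hε
    obtain ⟨t, -, htf, htK⟩ := hK.finite_cover_balls hε
    obtain ⟨n, y, rfl⟩ := htf.fin_param.imp fun n h => h.imp fun y h => h.2
    set w : Fin n → Z → ℝ := fun i z => max 0 (ε - dist z (y i))
    set S : Z → ℝ := fun z => ∑ i, w i z
    have hw0 : ∀ i z, 0 ≤ w i z := fun i z => le_max_left _ _
    have hwc : ∀ i, Continuous (w i) := fun i => by fun_prop
    have hSc : Continuous S := by fun_prop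
    have hS : ∀ z ∈ K, 0 < S z := by
      intro z hz
      obtain ⟨_, ⟨i, rfl⟩, hi⟩ := mem_iUnion₂.1 (htK hz)
      exact Finset.sum_pos' (fun i _ => hw0 i z) ⟨i, Finset.mem_univ _,
        lt_max_of_lt_right (sub_pos.2 (Metric.mem_ball.1 hi))⟩
    set p : EuclideanSpace ℝ (Fin n) → Z := fun x => ∑ i, x i • y i
    have hp : Continuous p := by fun_prop
    set F : EuclideanSpace ℝ (Fin n) → EuclideanSpace ℝ (Fin n) := fun x =>
      WithLp.toLp 2 fun i => w i (M (p x)) / S (M (p x))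
    have hF : Continuous F := by
      refine (PiLp.continuous_toLp 2 _).comp (continuous_pi fun i => ?_)
      exact ((hwc i).comp (hM.comp hp)).div (hSc.comp (hM.comp hp)) fun x => (hS _ (hMK _)).ne'
    have hFb : ∀ x, ‖F x‖ ≤ √n := by
      intro x
      rw [EuclideanSpace.norm_eq]
      refine Real.sqrt_le_sqrt ?_
      calc ∑ i, ‖F x i‖ ^ 2 ≤ ∑ _i : Fin n, (1 : ℝ) := by
            refine Finset.sum_le_sum fun i _ => ?_
            have h1 : 0 ≤ w i (M (p x)) / S (M (p x)) := div_nonneg (hw0 _ _) (hS _ (hMK _)).le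
            have h2 : w i (M (p x)) / S (M (p x)) ≤ 1 := by
              rw [div_le_one (hS _ (hMK _))]
              exact Finset.single_le_sum (f := fun i => w i (M (p x)))
                (fun i _ => hw0 i _) (Finset.mem_univ i)
            simp only [F, Real.norm_of_nonneg h1]
            exact pow_le_one₀ h1 h2
        _ = n := by simp
    obtain ⟨x, hx⟩ := exists_fixedPoint_of_continuous_of_bounded hF hFb
    refine ⟨p x, ?_⟩
    set z := M (p x)
    have hSz := hS z (hMK _)
    have hxi : ∀ i, x i = w i z / S z := fun i => by
      conv_lhs => rw [← hx]
    have hsum : ∑ i, x i = 1 := by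
      simp_rw [hxi]
      rw [← Finset.sum_div, div_self hSz.ne']
    have hpz : p x - z = ∑ i, x i • (y i - z) := by
      simp_rw [smul_sub, Finset.sum_sub_distrib, ← Finset.sum_smul, hsum, one_smul, p]
    rw [dist_eq_norm, hpz]
    calc ‖∑ i, x i • (y i - z)‖ ≤ ∑ i, ‖x i • (y i - z)‖ := norm_sum_le _ _
      _ ≤ ∑ i, x i * ε := by
          refine Finset.sum_le_sum fun i _ => ?_
          have h0 : 0 ≤ x i := by rw [hxi]; exact div_nonneg (hw0 _ _) hSz.le
          rw [norm_smul, Real.norm_of_nonneg h0]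
          by_cases hd : dist z (y i) ≤ ε
          · rw [norm_sub_rev, ← dist_eq_norm]
            exact mul_le_mul_of_nonneg_left hd h0
          · have : w i z = 0 := max_eq_left (by linarith)
            rw [hxi, this]; simp
      _ = ε := by rw [← Finset.sum_mul, hsum, one_mul]
  choose z hz using fun n : ℕ => approx (1 / (n + 1)) (by positivity)
  obtain ⟨x, -, θ, hθ, hlim⟩ := hK.tendsto_subseq fun n => hMK (z n)
  have hd : Tendsto (fun n => dist (z (θ n)) (M (z (θ n)))) atTop (nhds 0) :=
    squeeze_zero (fun _ => dist_nonneg) (fun n => hz (θ n))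
      (tendsto_one_div_add_atTop_nhds_zero_nat.comp hθ.tendsto_atTop)
  have hz' : Tendsto (fun n => z (θ n)) atTop (nhds x) :=
    (tendsto_iff_of_dist hd).2 hlim
  exact ⟨x, tendsto_nhds_unique ((hM.tendsto x).comp hz') hlim⟩

/-- A Leray–Schauder continuation principle: the fixed points of a compact homotopy ending at a
constant map cannot be separated into two closed parts, one containing the final fixed point and
the other containing all initial fixed points. -/
theorem not_separated_fixedPoints {X : Type*} [NormedAddCommGroup X] [NormedSpace ℝ X]
    {H : ℝ → X → X} (hH : Continuous fun z : ℝ × X => H z.1 z.2) {K : Set X} (hK : IsCompact K)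
    (hHK : ∀ s u, H s u ∈ K) {b : ℝ} (hb : 0 < b) {D D' : Set (ℝ × X)} (hD : IsClosed D)
    (hD' : IsClosed D') (hDD : ∀ z, z ∈ D ∨ z ∈ D')
    (hsep : ∀ s ∈ Icc 0 b, ∀ u, H s u = u → (s, u) ∈ D → (s, u) ∉ D')
    (h0 : ∀ u, H 0 u = u → (0, u) ∉ D) (h1 : ∀ u, H b u = u → (b, u) ∉ D') : False := by
  set S : Set (ℝ × X) := {z | z.1 ∈ Icc 0 b ∧ H z.1 z.2 = z.2}
  have hS : IsClosed S := (isClosed_Icc.preimage continuous_fst).inter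
    (isClosed_eq hH continuous_snd)
  have hdisj : Disjoint (S ∩ D') (S ∩ D) := by
    rw [Set.disjoint_left]
    rintro ⟨s, u⟩ ⟨⟨hs, hu⟩, hz'⟩ ⟨_, hz⟩
    exact hsep s hs u hu hz hz'
  obtain ⟨χ, hχ0, hχ1, -⟩ := exists_continuous_zero_one_of_isClosed (hS.inter hD') (hS.inter hD)
    hdisj
  set M : ℝ × X → ℝ × X := fun z => (max 0 (min b (z.1 + 1 - 2 * χ z)), H z.1 z.2)
  have hM : Continuous M := by fun_prop
  obtain ⟨⟨s, u⟩, hz⟩ := exists_fixedPoint_of_range_subset_compact hM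
    (isCompact_Icc.prod hK) (fun z => ⟨⟨le_max_left _ _, max_le hb.le (min_le_left _ _)⟩,
      hHK _ _⟩ : ∀ z, M z ∈ Icc 0 b ×ˢ K)
  obtain ⟨hs, hu⟩ := Prod.ext_iff.1 hz
  simp only [M] at hs hu
  have hsI : s ∈ Icc 0 b := by
    rw [← hs]; exact ⟨le_max_left _ _, max_le hb.le (min_le_left _ _)⟩
  have hzS : (s, u) ∈ S := ⟨hsI, hu⟩
  rcases hDD (s, u) with hd | hd
  · have hχ : χ (s, u) = 1 := hχ1 ⟨hzS, hd⟩
    rw [hχ, min_eq_right (by linarith [hsI.2])] at hs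
    have hs0 : s = 0 := by
      rcases le_total 0 (s + 1 - 2 * 1) with h | h
      · rw [max_eq_right h] at hs; linarith
      · rw [max_eq_left h] at hs; exact hs.symm
    subst hs0
    exact h0 u hu hd
  · have hχ : χ (s, u) = 0 := hχ0 ⟨hzS, hd⟩
    rw [hχ] at hs
    have hs0 : s = b := by
      rcases le_total b (s + 1 - 2 * 0) with h | h
      · rw [min_eq_left h, max_eq_right hb.le] at hs; exact hs.symm
      · rw [min_eq_right h, max_eq_right (by linarith [hsI.1])] at hs; linarith
    subst hs0
    exact h1 u hu hd

/-- A uniformly bounded, uniformly Lipschitz family of functions on an interval is compact. -/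
lemma isCompact_setOf_bounded_lipschitz (p q B L : ℝ) :
    IsCompact {h : C(Icc p q, ℝ) | (∀ t, |h t| ≤ B) ∧ ∀ t t', |h t - h t'| ≤ L * |(t : ℝ) - t'|} := by
  apply ArzelaAscoli.isCompact_of_equicontinuous
  · have himg : ContinuousMap.toFun '' {h : C(Icc p q, ℝ) | (∀ t, |h t| ≤ B) ∧
        ∀ t t', |h t - h t'| ≤ L * |(t : ℝ) - t'|} =
        (Set.univ.pi fun _ : Icc p q => Icc (-B) B) ∩
          {h | ∀ t t', |h t - h t'| ≤ L * |(t : ℝ) - t'|} := by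
      ext h
      constructor
      · rintro ⟨h, ⟨h1, h2⟩, rfl⟩
        exact ⟨fun t _ => abs_le.1 (h1 t), h2⟩
      · rintro ⟨h1, h2⟩
        have hc : Continuous h := by
          refine (LipschitzWith.of_dist_le_mul (K := Real.toNNReal L) fun t t' => ?_).continuous
          rw [Real.dist_eq, Subtype.dist_eq, Real.dist_eq]
          exact (h2 t t').trans (mul_le_mul_of_nonneg_right (Real.le_coe_toNNReal L) (abs_nonneg _))
        exact ⟨⟨h, hc⟩, ⟨fun t => abs_le.2 (h1 t trivial), h2⟩, rfl⟩
    rw [himg]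
    refine (isCompact_univ_pi fun _ => isCompact_Icc).inter_right ?_
    simp only [Set.ofPred_forall]
    exact isClosed_iInter fun t => isClosed_iInter fun t' =>
      isClosed_le (by fun_prop) continuous_const
  · refine Metric.equicontinuous_of_continuity_modulus (fun d => L * d) ?_ _ ?_
    · exact (by fun_prop : Continuous fun d : ℝ => L * d).tendsto' 0 0 (by simp)
    · rintro t t' ⟨h, hh⟩
      rw [Real.dist_eq, Subtype.dist_eq, Real.dist_eq]
      exact hh.2 t t'

section Operators

variable {p q : ℝ} (hpq : p ≤ q)

lemma continuous_iccExtend (v : C(Icc p q, ℝ)) : Continuous (IccExtend hpq v) :=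
  v.continuous.Icc_extend'

lemma abs_iccExtend_le (v : C(Icc p q, ℝ)) (t : ℝ) : |IccExtend hpq v t| ≤ ‖v‖ :=
  v.norm_coe_le_norm (projIcc p q hpq t)

lemma intervalIntegrable_mul_iccExtend {b : ℝ → ℝ}
    (hb : ∀ x y, IntervalIntegrable b volume x y) (v : C(Icc p q, ℝ)) (x y : ℝ) :
    IntervalIntegrable (fun s => b s * IccExtend hpq v s) volume x y :=
  (hb x y).mul_continuousOn (continuous_iccExtend hpq v).continuousOn

/-- The operator `v ↦ ∫_p^t b v` on `C([p, q])`. -/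
def primOp (b : ℝ → ℝ) (hb : ∀ x y, IntervalIntegrable b volume x y) (v : C(Icc p q, ℝ)) :
    C(Icc p q, ℝ) where
  toFun t := ∫ s in p..t, b s * IccExtend hpq v s
  continuous_toFun := (intervalIntegral.continuous_primitive
    (intervalIntegrable_mul_iccExtend hpq hb v) p).comp continuous_subtype_val

lemma abs_integral_mul_iccExtend_le {b : ℝ → ℝ} (hb : ∀ x y, IntervalIntegrable b volume x y)
    (v : C(Icc p q, ℝ)) {t : ℝ} (ht : t ∈ Icc p q) :
    |∫ s in p..t, b s * IccExtend hpq v s| ≤ (∫ s in p..q, |b s|) * ‖v‖ := by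
  calc |∫ s in p..t, b s * IccExtend hpq v s|
      ≤ ∫ s in p..t, |b s * IccExtend hpq v s| := intervalIntegral.abs_integral_le_integral_abs ht.1
    _ ≤ ∫ s in p..t, |b s| * ‖v‖ := by
        refine intervalIntegral.integral_mono_on ht.1
          (intervalIntegrable_mul_iccExtend hpq hb v p t).abs ((hb p t).abs.mul_const _) ?_
        intro s _
        rw [abs_mul]
        exact mul_le_mul_of_nonneg_left (abs_iccExtend_le hpq v s) (abs_nonneg _)
    _ = (∫ s in p..t, |b s|) * ‖v‖ := intervalIntegral.integral_mul_const _ _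
    _ ≤ (∫ s in p..q, |b s|) * ‖v‖ := by
        refine mul_le_mul_of_nonneg_right ?_ (norm_nonneg _)
        exact intervalIntegral.integral_mono_interval le_rfl ht.1 ht.2
          (Eventually.of_forall fun s => abs_nonneg _) (hb p q).abs

lemma norm_primOp_le {b : ℝ → ℝ} (hb : ∀ x y, IntervalIntegrable b volume x y)
    (v : C(Icc p q, ℝ)) : ‖primOp hpq b hb v‖ ≤ (∫ s in p..q, |b s|) * ‖v‖ := by
  refine (ContinuousMap.norm_le _ ?_).2 fun t => abs_integral_mul_iccExtend_le hpq hb v t.2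
  exact mul_nonneg (intervalIntegral.integral_nonneg hpq fun s _ => abs_nonneg _) (norm_nonneg _)

lemma primOp_sub {b : ℝ → ℝ} (hb : ∀ x y, IntervalIntegrable b volume x y)
    (v v' : C(Icc p q, ℝ)) : primOp hpq b hb v - primOp hpq b hb v' = primOp hpq b hb (v - v') := by
  ext t
  simp only [ContinuousMap.sub_apply, primOp, ContinuousMap.coe_mk]
  rw [← intervalIntegral.integral_sub (intervalIntegrable_mul_iccExtend hpq hb v p t)
    (intervalIntegrable_mul_iccExtend hpq hb v' p t)]
  refine intervalIntegral.integral_congr fun s _ => ?_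
  simp [IccExtend, mul_sub]

lemma continuous_primOp {b : ℝ → ℝ} (hb : ∀ x y, IntervalIntegrable b volume x y) :
    Continuous (primOp hpq b hb) := by
  refine (LipschitzWith.of_dist_le_mul (K := Real.toNNReal (∫ s in p..q, |b s|))
    fun v v' => ?_).continuous
  rw [dist_eq_norm, dist_eq_norm, primOp_sub]
  exact (norm_primOp_le hpq hb _).trans
    (mul_le_mul_of_nonneg_right (Real.le_coe_toNNReal _) (norm_nonneg _))

/-- For strictly increasing `ψ` with `ψ 0 = 0`, there is a constant `c` such that `ψ (c + y)` has
zero integral. -/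
lemma exists_integral_comp_add_eq_zero {ψ : ℝ → ℝ} (hψ : Continuous ψ) (hψm : StrictMono ψ)
    (hψ0 : ψ 0 = 0) (y : C(Icc p q, ℝ)) :
    ∃ c : ℝ, |c| ≤ ‖y‖ ∧ ∫ t in p..q, ψ (c + IccExtend hpq y t) = 0 := by
  have hy := continuous_iccExtend hpq y
  have hcont : Continuous fun c => ∫ t in p..q, ψ (c + IccExtend hpq y t) := by
    refine intervalIntegral.continuous_parametric_intervalIntegral_of_continuous' ?_ p q
    exact hψ.comp (continuous_fst.add (hy.comp continuous_snd))
  have hb := fun t => abs_le.1 (abs_iccExtend_le hpq y t)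
  obtain ⟨c, hc, hc0⟩ := intermediate_value_Icc (show -‖y‖ ≤ ‖y‖ by linarith [norm_nonneg y])
    hcont.continuousOn (show (0 : ℝ) ∈ Icc _ _ by
      constructor
      · rw [← neg_nonneg, ← intervalIntegral.integral_neg]
        refine intervalIntegral.integral_nonneg hpq fun t _ => ?_
        rw [neg_nonneg, ← hψ0]; exact hψm.monotone (by linarith [(hb t).2])
      · refine intervalIntegral.integral_nonneg hpq fun t _ => ?_
        rw [← hψ0]; exact hψm.monotone (by linarith [(hb t).1]))
  exact ⟨c, abs_le.2 hc, hc0⟩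

lemma le_add_norm_sub_of_integral_eq_zero (hlt : p < q) {ψ : ℝ → ℝ} (hψ : Continuous ψ)
    (hψm : StrictMono ψ) {y y' : C(Icc p q, ℝ)} {c c' : ℝ}
    (hc : ∫ t in p..q, ψ (c + IccExtend hpq y t) = 0)
    (hc' : ∫ t in p..q, ψ (c' + IccExtend hpq y' t) = 0) : c ≤ c' + ‖y - y'‖ := by
  by_contra hcon
  have hstrict : ∀ t, ψ (c' + IccExtend hpq y' t) < ψ (c + IccExtend hpq y t) := by
    intro t
    refine hψm ?_
    have h1 := (abs_le.1 (abs_iccExtend_le hpq (y - y') t)).1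
    have h2 : IccExtend hpq (y - y') t = IccExtend hpq y t - IccExtend hpq y' t := rfl
    rw [h2] at h1
    linarith
  have hlt' : ∫ t in p..q, ψ (c' + IccExtend hpq y' t) < ∫ t in p..q, ψ (c + IccExtend hpq y t) :=
    intervalIntegral.integral_lt_integral_of_continuousOn_of_le_of_exists_lt hlt
    (hψ.comp (continuous_const.add (continuous_iccExtend hpq y'))).continuousOn
    (hψ.comp (continuous_const.add (continuous_iccExtend hpq y))).continuousOn
    (fun t _ => (hstrict t).le) ⟨p, left_mem_Icc.2 hpq, hstrict p⟩
  rw [hc, hc'] at hlt'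
  exact lt_irrefl _ hlt'

/-- The solution operator of the Dirichlet-type problem `φ(v')' = y'`, `v p = v q = 0`, where
`ψ = φ⁻¹`: it is continuous, and it maps bounded sets into compact sets. -/
lemma exists_solutionOperator (hlt : p < q) {ψ : ℝ → ℝ} (hψ : Continuous ψ) (hψm : StrictMono ψ)
    (hψ0 : ψ 0 = 0) :
    ∃ V : C(Icc p q, ℝ) → C(Icc p q, ℝ), Continuous V ∧
      (∀ y, ∃ c : ℝ, (∀ t : Icc p q, V y t = ∫ s in p..t, ψ (c + IccExtend hpq y s)) ∧
        ∫ s in p..q, ψ (c + IccExtend hpq y s) = 0) ∧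
      ∀ B, ∃ L, ∀ y, ‖y‖ ≤ B → (∀ t, |V y t| ≤ L * (q - p)) ∧
        ∀ t t', |V y t - V y t'| ≤ L * |(t : ℝ) - t'| := by
  choose c hcb hc using exists_integral_comp_add_eq_zero hpq hψ hψm hψ0
  have hcc : Continuous c := by
    refine (LipschitzWith.of_dist_le_mul (K := 1) fun y y' => ?_).continuous
    rw [Real.dist_eq, dist_eq_norm, NNReal.coe_one, one_mul, abs_le]
    have h1 := le_add_norm_sub_of_integral_eq_zero hpq hlt hψ hψm (hc y) (hc y')
    have h2 := le_add_norm_sub_of_integral_eq_zero hpq hlt hψ hψm (hc y') (hc y)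
    rw [norm_sub_rev] at h2
    constructor <;> linarith
  have h1 : ∀ x y, IntervalIntegrable (fun _ : ℝ => (1 : ℝ)) volume x y := fun x y =>
    intervalIntegrable_const
  set V : C(Icc p q, ℝ) → C(Icc p q, ℝ) := fun y =>
    primOp hpq (fun _ => 1) h1 ((⟨ψ, hψ⟩ : C(ℝ, ℝ)).comp (ContinuousMap.const _ (c y) + y))
  have hVe : ∀ y, ∀ t : Icc p q, V y t = ∫ s in p..t, ψ (c y + IccExtend hpq y s) := by
    intro y t
    simp [V, primOp, IccExtend]
  refine ⟨V, ?_, fun y => ⟨c y, hVe y, hc y⟩, fun B => ?_⟩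
  · refine (continuous_primOp hpq h1).comp ((ContinuousMap.continuous_postcomp _).comp ?_)
    exact (ContinuousMap.continuous_const'.comp hcc).add continuous_id
  · set L := max |ψ (-(2 * B))| |ψ (2 * B)|
    have hbound : ∀ y, ‖y‖ ≤ B → ∀ s, |ψ (c y + IccExtend hpq y s)| ≤ L := by
      intro y hy s
      have h2 := abs_le.1 ((hcb y).trans hy)
      have h3 := abs_le.1 ((abs_iccExtend_le hpq y s).trans hy)
      refine abs_le_max_abs_abs ?_ ?_
      · exact hψm.monotone (by linarith)
      · exact hψm.monotone (by linarith)
    have hlip : ∀ y, ‖y‖ ≤ B → ∀ t t', |V y t - V y t'| ≤ L * |(t : ℝ) - t'| := by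
      intro y hy t t'
      have hint : ∀ x z, IntervalIntegrable (fun s => ψ (c y + IccExtend hpq y s)) volume x z :=
        fun x z => (hψ.comp (continuous_const.add (continuous_iccExtend hpq y))).intervalIntegrable
          x z
      rw [hVe, hVe, intervalIntegral.integral_interval_sub_left (hint _ _) (hint _ _)]
      exact intervalIntegral.norm_integral_le_of_norm_le_const
        (f := fun s => ψ (c y + IccExtend hpq y s)) fun s _ => hbound y hy s
    refine ⟨L, fun y hy => ⟨fun t => ?_, hlip y hy⟩⟩
    have h0 : V y ⟨p, left_mem_Icc.2 hpq⟩ = 0 := by rw [hVe]; simp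
    have h2 := hlip y hy t ⟨p, left_mem_Icc.2 hpq⟩
    rw [h0, sub_zero] at h2
    refine h2.trans (mul_le_mul_of_nonneg_left ?_ (le_max_of_le_left (abs_nonneg _)))
    rw [abs_of_nonneg (sub_nonneg.2 t.2.1)]
    linarith [t.2.2]

end Operators

/-- `U` is a `T`-periodic solution of `U' = ψ(Q)`, `Q' = -f(t, U)`. -/
structure IsPeriodicSol (T : ℝ) (ψ : ℝ → ℝ) (f : ℝ → ℝ → ℝ) (U Q : ℝ → ℝ) : Prop where
  periodic : Function.Periodic U T
  periodic_momentum : Function.Periodic Q T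
  hasDerivAt : ∀ t, HasDerivAt U (ψ (Q t)) t
  intervalIntegrable : ∀ x y, IntervalIntegrable (fun t => f t (U t)) volume x y
  sub_eq : ∀ x y, Q y - Q x = -∫ t in x..y, f t (U t)

lemma periodic_integral_of_integral_eq_zero {T p : ℝ} {h : ℝ → ℝ} (hper : Function.Periodic h T)
    (hint : ∀ x y, IntervalIntegrable h volume x y) (hzero : ∫ t in p..p + T, h t = 0) :
    Function.Periodic (fun t => ∫ s in p..t, h s) T := by
  intro t
  have h1 := hper.intervalIntegral_add_eq t p
  rw [hzero] at h1
  have h2 := intervalIntegral.integral_add_adjacent_intervals (hint p t) (hint t (t + T))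
  simp only
  linarith

lemma Function.Periodic.apply_toIcoMod {T : ℝ} (hT : 0 < T) {W : ℝ → ℝ}
    (hW : Function.Periodic W T) (p t : ℝ) : W (toIcoMod hT p t) = W t := by
  rw [toIcoMod]
  exact hW.sub_zsmul_eq _

lemma exists_isPeriodicSol {T p : ℝ} (hT : 0 < T) {ψ : ℝ → ℝ} (hψ : Continuous ψ)
    {f : ℝ → ℝ → ℝ} (hf : ∀ x, Function.Periodic (fun t => f t x) T)
    (u : C(Icc p (p + T), ℝ)) {c : ℝ}
    (hpT : p ≤ p + T)
    (hint : ∀ x y, IntervalIntegrable (fun s => f s (IccExtend hpT u s)) volume x y)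
    (hu : ∀ t : Icc p (p + T), u t = u ⟨p, left_mem_Icc.2 hpT⟩ +
      ∫ s in p..t, ψ (c - ∫ τ in p..s, f τ (IccExtend hpT u τ)))
    (huq : u ⟨p + T, right_mem_Icc.2 hpT⟩ = u ⟨p, left_mem_Icc.2 hpT⟩)
    (hzero : ∫ s in p..p + T, f s (IccExtend hpT u s) = 0) :
    ∃ U Q, IsPeriodicSol T ψ f U Q ∧ ∀ t : Icc p (p + T), U t = u t := by
  set U : ℝ → ℝ := fun t => IccExtend hpT u (toIcoMod hT p t) with hU
  have hUper : Function.Periodic U T := by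
    intro t
    simp [hU, toIcoMod_add_right]
  have hUu : ∀ t ∈ Icc p (p + T), U t = IccExtend hpT u t := by
    intro t ht
    rcases eq_or_lt_of_le ht.2 with rfl | hlt
    · have : toIcoMod hT p (p + T) = p := by simp
      rw [hU]
      simp only [this]
      rw [IccExtend_left, IccExtend_right, huq]
    · have : toIcoMod hT p t = t := (toIcoMod_eq_self hT).2 ⟨ht.1, hlt⟩
      rw [hU]
      simp only [this]
  have hfper : Function.Periodic (fun t => f t (U t)) T := by
    intro t
    simp only
    rw [hUper t]
    exact hf (U t) t
  have hcongr : ∀ t ∈ Icc p (p + T), ∀ s ∈ uIcc p t,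
      f s (U s) = f s (IccExtend hpT u s) := by
    intro t ht s hs
    rw [uIcc_of_le ht.1] at hs
    rw [hUu s ⟨hs.1, hs.2.trans ht.2⟩]
  have hUint : ∀ x y, IntervalIntegrable (fun t => f t (U t)) volume x y := by
    intro x y
    refine hfper.intervalIntegrable hT.ne' (t := p) ?_ x y
    refine (hint p (p + T)).congr ?_
    intro s hs
    exact (hcongr _ ⟨hpT, le_rfl⟩ s (uIoc_subset_uIcc hs)).symm
  have hUzero : ∫ t in p..p + T, f t (U t) = 0 := by
    rw [← hzero]
    exact intervalIntegral.integral_congr (hcongr _ ⟨hpT, le_rfl⟩)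
  set Q : ℝ → ℝ := fun t => c - ∫ s in p..t, f s (U s) with hQ
  have hQper : Function.Periodic Q T := fun t => by
    have := periodic_integral_of_integral_eq_zero hfper hUint hUzero t
    simp only [hQ] at this ⊢
    rw [this]
  have hQc : Continuous Q := continuous_const.sub (intervalIntegral.continuous_primitive hUint p)
  have hψQ : Continuous fun t => ψ (Q t) := hψ.comp hQc
  have hW : ∀ t ∈ Icc p (p + T), U t = u ⟨p, left_mem_Icc.2 hpT⟩ + ∫ s in p..t, ψ (Q s) := by
    intro t ht
    rw [hUu t ht, IccExtend_of_mem _ _ ht, hu ⟨t, ht⟩]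
    congr 1
    refine intervalIntegral.integral_congr fun s hs => ?_
    rw [uIcc_of_le ht.1] at hs
    simp only [hQ]
    rw [intervalIntegral.integral_congr (hcongr s ⟨hs.1, hs.2.trans ht.2⟩)]
  have hψzero : ∫ s in p..p + T, ψ (Q s) = 0 := by
    have h1 := hW (p + T) ⟨hpT, le_rfl⟩
    rw [hUu _ ⟨hpT, le_rfl⟩, IccExtend_right, huq] at h1
    linarith
  have hper2 := periodic_integral_of_integral_eq_zero
    (h := fun t => ψ (Q t)) (T := T) (p := p) (fun t => by simp only [hQper t])
    (fun x y => hψQ.intervalIntegrable x y) hψzero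
  have hUeq : U = fun t => u ⟨p, left_mem_Icc.2 hpT⟩ + ∫ s in p..t, ψ (Q s) := by
    funext t
    have hmem := toIcoMod_mem_Ico hT p t
    have h1 := hW _ ⟨hmem.1, hmem.2.le⟩
    rw [hUper.apply_toIcoMod hT] at h1
    have h2 := hper2.apply_toIcoMod hT p t
    rw [h1, h2]
  refine ⟨U, Q, ⟨hUper, hQper, fun t => ?_, hUint, fun x y => ?_⟩, fun t => ?_⟩
  · have h1 : HasDerivAt (fun t => ∫ s in p..t, ψ (Q s)) (ψ (Q t)) t :=
      intervalIntegral.integral_hasDerivAt_right (hψQ.intervalIntegrable _ _)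
        (hψQ.stronglyMeasurableAtFilter _ _) hψQ.continuousAt
    rw [hUeq]
    exact h1.const_add _
  · have h1 := intervalIntegral.integral_interval_sub_left (hUint p y) (hUint p x)
    simp only [hQ]
    linarith
  · rw [hUu t t.2, IccExtend_of_mem _ _ t.2]

/-- The right-hand side of the auxiliary problems joining the original equation to
equations without solutions. -/
def auxRhs (b₁ b₂ G : ℝ → ℝ) (ϑ α t x : ℝ) : ℝ :=
  ϑ * (b₁ t * G x + max 0 (min 1 (-x)) + α * b₂ t)

/-- The primitive, starting at `p`, of `auxRhs b₁ b₂ G 1 α t (u t)`. -/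
def auxPrim {p q : ℝ} (hpq : p ≤ q) {b₁ b₂ G : ℝ → ℝ}
    (hb₁ : ∀ x y, IntervalIntegrable b₁ volume x y)
    (hb₂ : ∀ x y, IntervalIntegrable b₂ volume x y) (hG : Continuous G) (α : ℝ)
    (u : C(Icc p q, ℝ)) : C(Icc p q, ℝ) :=
  primOp hpq b₁ hb₁ ((⟨G, hG⟩ : C(ℝ, ℝ)).comp u) +
    primOp hpq (fun _ => 1) (fun _ _ => intervalIntegrable_const)
      ((⟨fun x => max 0 (min 1 (-x)), by fun_prop⟩ : C(ℝ, ℝ)).comp u) +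
    α • primOp hpq b₂ hb₂ 1

section

variable {p q : ℝ} (hpq : p ≤ q) {b₁ b₂ G : ℝ → ℝ}
    (hb₁ : ∀ x y, IntervalIntegrable b₁ volume x y)
    (hb₂ : ∀ x y, IntervalIntegrable b₂ volume x y) (hG : Continuous G)

include hb₁ hb₂ hG in
lemma intervalIntegrable_auxRhs {v : ℝ → ℝ} (hv : Continuous v) (ϑ α x y : ℝ) :
    IntervalIntegrable (fun t => auxRhs b₁ b₂ G ϑ α t (v t)) volume x y := by
  have h1 : IntervalIntegrable (fun t => b₁ t * G (v t)) volume x y :=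
    (hb₁ x y).mul_continuousOn (hG.comp hv).continuousOn
  have h2 : IntervalIntegrable (fun t => max 0 (min 1 (-(v t)))) volume x y :=
    (by fun_prop : Continuous fun t => max 0 (min 1 (-(v t)))).intervalIntegrable x y
  exact ((h1.add h2).add ((hb₂ x y).const_mul α)).const_mul ϑ

lemma mul_auxPrim_apply (ϑ α : ℝ) (u : C(Icc p q, ℝ)) (t : Icc p q) :
    ϑ * auxPrim hpq hb₁ hb₂ hG α u t =
      ∫ s in p..t, auxRhs b₁ b₂ G ϑ α s (IccExtend hpq u s) := by
  have hv := continuous_iccExtend hpq u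
  have h1 : IntervalIntegrable (fun s => b₁ s * G (IccExtend hpq u s)) volume p t :=
    (hb₁ p t).mul_continuousOn (hG.comp hv).continuousOn
  have h2 : IntervalIntegrable (fun s => max 0 (min 1 (-(IccExtend hpq u s)))) volume p t :=
    (by fun_prop : Continuous fun s => max 0 (min 1 (-(IccExtend hpq u s)))).intervalIntegrable p t
  simp only [auxRhs]
  rw [intervalIntegral.integral_const_mul,
    intervalIntegral.integral_add (h1.add h2) ((hb₂ p t).const_mul α),
    intervalIntegral.integral_add h1 h2, intervalIntegral.integral_const_mul]
  simp [auxPrim, primOp, IccExtend]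

lemma norm_auxPrim_le {BG : ℝ} (hBG : ∀ x, |G x| ≤ BG) {α αmax : ℝ} (hα : |α| ≤ αmax)
    (u : C(Icc p q, ℝ)) :
    ‖auxPrim hpq hb₁ hb₂ hG α u‖ ≤
      (∫ s in p..q, |b₁ s|) * BG + (q - p) + αmax * ∫ s in p..q, |b₂ s| := by
  have hI1 : 0 ≤ ∫ s in p..q, |b₁ s| :=
    intervalIntegral.integral_nonneg hpq fun s _ => abs_nonneg _
  have hI2 : 0 ≤ ∫ s in p..q, |b₂ s| :=
    intervalIntegral.integral_nonneg hpq fun s _ => abs_nonneg _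
  have hBG0 : 0 ≤ BG := (abs_nonneg _).trans (hBG 0)
  refine (norm_add_le _ _).trans (add_le_add ((norm_add_le _ _).trans (add_le_add ?_ ?_)) ?_)
  · refine (norm_primOp_le hpq hb₁ _).trans (mul_le_mul_of_nonneg_left ?_ hI1)
    exact (ContinuousMap.norm_le _ hBG0).2 fun t => hBG _
  · refine (norm_primOp_le hpq _ _).trans ?_
    have h1 : ‖(⟨fun x => max 0 (min 1 (-x)), by fun_prop⟩ : C(ℝ, ℝ)).comp u‖ ≤ 1 := by
      refine (ContinuousMap.norm_le _ zero_le_one).2 fun t => ?_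
      rw [Real.norm_eq_abs, abs_le]
      exact ⟨by simp, max_le zero_le_one (min_le_left _ _)⟩
    calc _ ≤ (∫ s in p..q, |(1 : ℝ)|) * 1 := mul_le_mul_of_nonneg_left h1
          (intervalIntegral.integral_nonneg hpq fun s _ => abs_nonneg _)
      _ = q - p := by simp
  · rw [norm_smul]
    refine mul_le_mul hα ?_ (norm_nonneg _) ((abs_nonneg _).trans hα)
    refine (norm_primOp_le hpq hb₂ _).trans ?_
    have h1 : ‖(1 : C(Icc p q, ℝ))‖ ≤ 1 :=
      (ContinuousMap.norm_le _ zero_le_one).2 fun t => by simp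
    calc _ ≤ (∫ s in p..q, |b₂ s|) * 1 := mul_le_mul_of_nonneg_left h1 hI2
      _ = _ := mul_one _

lemma continuous_auxPrim :
    Continuous fun z : ℝ × C(Icc p q, ℝ) => auxPrim hpq hb₁ hb₂ hG z.1 z.2 := by
  unfold auxPrim
  refine ((((continuous_primOp hpq hb₁).comp ((ContinuousMap.continuous_postcomp _).comp
    continuous_snd)).add ((continuous_primOp hpq _).comp ((ContinuousMap.continuous_postcomp _).comp
    continuous_snd))).add (continuous_fst.smul continuous_const))

end

/-- If the `a priori` bounds hold along the homotopy, then the original problem has a periodic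
solution whose maximum lies in `[r, R]`. -/
theorem exists_isPeriodicSol_of_apriori {T p : ℝ} (hT : 0 < T) {ψ : ℝ → ℝ} (hψ : Continuous ψ)
    (hψm : StrictMono ψ) (hψ0 : ψ 0 = 0) {b₁ b₂ G : ℝ → ℝ}
    (hb₁ : ∀ x y, IntervalIntegrable b₁ volume x y)
    (hb₂ : ∀ x y, IntervalIntegrable b₂ volume x y)
    (hper₁ : Function.Periodic b₁ T) (hper₂ : Function.Periodic b₂ T)
    (hneg : ∫ t in p..p + T, b₁ t < 0) (hG : Continuous G) (hG0 : ∀ x ≤ 0, G x = 0) {BG : ℝ}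
    (hBG : ∀ x, |G x| ≤ BG) {r R αmax : ℝ} (hr : 0 < r) (hrR : r < R) (hGr : 0 < G r)
    (hαmax : 0 ≤ αmax)
    (hnonneg : ∀ ϑ α U Q, 0 < ϑ → 0 ≤ α → IsPeriodicSol T ψ (auxRhs b₁ b₂ G ϑ α) U Q →
      ∀ t, 0 ≤ U t)
    (hbound : ∀ α U Q, 0 ≤ α → IsPeriodicSol T ψ (auxRhs b₁ b₂ G 1 α) U Q →
      (∀ t, U t ≤ R) → ∀ t, U t < R)
    (hnone : ∀ U Q, IsPeriodicSol T ψ (auxRhs b₁ b₂ G 1 αmax) U Q → (∀ t, U t ≤ R) → False)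
    (hsmall : ∀ ϑ U Q, 0 < ϑ → ϑ ≤ 1 → IsPeriodicSol T ψ (auxRhs b₁ b₂ G ϑ 0) U Q →
      (∀ t, U t ≤ r) → ∀ t, U t < r) :
    ∃ U Q, IsPeriodicSol T ψ (auxRhs b₁ b₂ G 1 0) U Q ∧ (∀ t, U t ≤ R) ∧ ∃ t, r ≤ U t := by
  by_contra hcon
  push Not at hcon
  have hlt : p < p + T := by linarith
  have hpq := hlt.le
  obtain ⟨V, hVc, hV, hVb⟩ := exists_solutionOperator hpq hlt hψ hψm hψ0
  set P : Icc p (p + T) := ⟨p, left_mem_Icc.2 hpq⟩ with hP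
  set E : Icc p (p + T) := ⟨p + T, right_mem_Icc.2 hpq⟩ with hE
  set al : ℝ → ℝ := fun s => αmax * max 0 (min 1 (1 - s)) with hal
  set th : ℝ → ℝ := fun s => max 0 (min 1 (2 - s)) with hth
  set ka : ℝ → ℝ := fun s => max 0 (min 1 (s - 2)) with hka
  have halc : Continuous al := by fun_prop
  have hthc : Continuous th := by fun_prop
  have hkac : Continuous ka := by fun_prop
  have h01 : ∀ x : ℝ, 0 ≤ max 0 (min 1 x) ∧ max 0 (min 1 x) ≤ 1 := fun x =>
    ⟨le_max_left _ _, max_le zero_le_one (min_le_left _ _)⟩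
  set A : ℝ → C(Icc p (p + T), ℝ) → C(Icc p (p + T), ℝ) := fun s u =>
    auxPrim hpq hb₁ hb₂ hG (al s) u with hA
  have hAc : Continuous fun z : ℝ × C(Icc p (p + T), ℝ) => A z.1 z.2 :=
    (continuous_auxPrim hpq hb₁ hb₂ hG).comp ((halc.comp continuous_fst).prodMk continuous_snd)
  set BA : ℝ := (∫ s in p..p + T, |b₁ s|) * BG + (p + T - p) + αmax * ∫ s in p..p + T, |b₂ s|
  have hAb : ∀ s u, ‖A s u‖ ≤ BA := fun s u => by
    refine norm_auxPrim_le hpq hb₁ hb₂ hG hBG ?_ u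
    rw [hal, abs_of_nonneg (mul_nonneg hαmax (h01 _).1)]
    exact mul_le_of_le_one_right hαmax (h01 _).2
  set m : ℝ → C(Icc p (p + T), ℝ) → ℝ := fun s u => A s u E / T with hm
  have hmc : Continuous fun z : ℝ × C(Icc p (p + T), ℝ) => m z.1 z.2 :=
    ((continuous_eval_const E).comp hAc).div_const T
  have hmb : ∀ s u, |m s u| ≤ BA / T := fun s u => by
    rw [hm, abs_div, abs_of_pos hT]
    exact div_le_div_of_nonneg_right (((A s u).norm_coe_le_norm E).trans (hAb s u)) hT.le
  set lin : C(Icc p (p + T), ℝ) := ⟨fun t => t - p, by fun_prop⟩ with hlin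
  have hlinb : ‖lin‖ ≤ T := (ContinuousMap.norm_le _ hT.le).2 fun t => by
    rw [Real.norm_eq_abs, hlin, ContinuousMap.coe_mk, abs_of_nonneg (sub_nonneg.2 t.2.1)]
    linarith [t.2.2]
  set y : ℝ → C(Icc p (p + T), ℝ) → C(Icc p (p + T), ℝ) := fun s u =>
    -(th s • (A s u - m s u • lin)) with hy
  have hyc : Continuous fun z : ℝ × C(Icc p (p + T), ℝ) => y z.1 z.2 :=
    ((hthc.comp continuous_fst).smul (hAc.sub (hmc.smul continuous_const))).neg
  have hyb : ∀ s u, ‖y s u‖ ≤ BA + BA := fun s u => by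
    rw [hy, norm_neg, norm_smul, Real.norm_eq_abs, abs_of_nonneg (h01 _).1]
    have h1 : ‖A s u - m s u • lin‖ ≤ BA + BA := by
      refine (norm_sub_le _ _).trans (add_le_add (hAb s u) ?_)
      rw [norm_smul, Real.norm_eq_abs]
      calc |m s u| * ‖lin‖ ≤ BA / T * T := mul_le_mul (hmb s u) hlinb (norm_nonneg _)
            ((abs_nonneg _).trans (hmb s u))
        _ = BA := div_mul_cancel₀ _ hT.ne'
    exact (mul_le_of_le_one_left (norm_nonneg _) (h01 _).2).trans h1
  set H : ℝ → C(Icc p (p + T), ℝ) → C(Icc p (p + T), ℝ) := fun s u =>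
    ContinuousMap.const _ ((1 - ka s) * (max (-1) (min R (u P)) + m s u)) + V (y s u) with hH
  have hHc : Continuous fun z : ℝ × C(Icc p (p + T), ℝ) => H z.1 z.2 := by
    refine (ContinuousMap.continuous_const'.comp ?_).add (hVc.comp hyc)
    have h1 : Continuous fun z : ℝ × C(Icc p (p + T), ℝ) => z.2 P :=
      (continuous_eval_const P).comp continuous_snd
    exact (continuous_const.sub (hkac.comp continuous_fst)).mul
      ((continuous_const.max (continuous_const.min h1)).add hmc)
  obtain ⟨L, hL⟩ := hVb (BA + BA)
  have hHK : ∀ s u, H s u ∈ {h : C(Icc p (p + T), ℝ) |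
      (∀ t, |h t| ≤ (1 + R + BA / T) + L * (p + T - p)) ∧
        ∀ t t', |h t - h t'| ≤ L * |(t : ℝ) - t'|} := by
    intro s u
    obtain ⟨hL1, hL2⟩ := hL (y s u) (hyb s u)
    refine ⟨fun t => ?_, fun t t' => ?_⟩
    · have h1 : |(1 - ka s) * (max (-1) (min R (u P)) + m s u)| ≤ 1 + R + BA / T := by
        rw [abs_mul]
        have h2 : |1 - ka s| ≤ 1 := abs_le.2 ⟨by linarith [(h01 (s - 2)).2],
          by linarith [(h01 (s - 2)).1]⟩
        have h3 : |max (-1) (min R (u P)) + m s u| ≤ 1 + R + BA / T := by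
          refine (abs_add_le _ _).trans (add_le_add ?_ (hmb s u))
          refine abs_le.2 ⟨by linarith [le_max_left (-1) (min R (u P))], max_le ?_ ?_⟩
          · linarith
          · linarith [min_le_left R (u P)]
        exact (mul_le_of_le_one_left (abs_nonneg _) h2).trans h3
      exact (abs_add_le _ _).trans (add_le_add h1 (hL1 t))
    · simpa [hH] using hL2 t t'
  -- properties of the fixed points
  have hVP : ∀ y, V y P = 0 := fun y => by
    obtain ⟨c, hc, -⟩ := hV y
    rw [hc]; simp [hP]
  have hVE : ∀ y, V y E = 0 := fun y => by
    obtain ⟨c, hc, hc0⟩ := hV y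
    rw [hc, ← hc0]
  have hV0 : V 0 = 0 := by
    obtain ⟨c, hc, hc0⟩ := hV 0
    have h1 : ψ c = 0 := by
      have : ∫ s in p..p + T, ψ (c + IccExtend hpq (0 : C(Icc p (p + T), ℝ)) s) = T * ψ c := by
        simp [IccExtend]
      rw [this] at hc0
      exact (mul_eq_zero.1 hc0).resolve_left hT.ne'
    ext t
    rw [hc]
    simp [IccExtend, h1]
  have hfixP : ∀ s u, H s u = u →
      u P = (1 - ka s) * (max (-1) (min R (u P)) + m s u) := fun s u hu => by
    have h1 := DFunLike.congr_fun hu P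
    simp only [hH, ContinuousMap.add_apply, ContinuousMap.const_apply, hVP, add_zero] at h1
    exact h1.symm
  have hsol : ∀ s u, H s u = u → s ≤ 2 → 0 < th s → (∀ t, -1 ≤ u t ∧ u t ≤ R) →
      ∃ U Q, IsPeriodicSol T ψ (auxRhs b₁ b₂ G (th s) (al s)) U Q ∧
        ∀ t : Icc p (p + T), U t = u t := by
    intro s u hu hs hths hub
    have hk : ka s = 0 := max_eq_left ((min_le_right _ _).trans (by linarith))
    have hm0 : m s u = 0 := by
      have h1 := hfixP s u hu
      rw [hk, min_eq_right (hub P).2, max_eq_right (hub P).1] at h1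
      linarith
    have hAE : A s u E = 0 := by
      have h1 := div_mul_cancel₀ (A s u E) hT.ne'
      rw [show A s u E / T = m s u from rfl, hm0, zero_mul] at h1
      exact h1.symm
    have hyA : y s u = -(th s • A s u) := by simp only [hy, hm0, zero_smul, sub_zero]
    obtain ⟨c, hc, hc0⟩ := hV (y s u)
    have hext : ∀ t : Icc p (p + T), u t = u P + V (y s u) t := fun t => by
      have h1 := DFunLike.congr_fun hu t
      have h2 := DFunLike.congr_fun hu P
      simp only [hH, ContinuousMap.add_apply, ContinuousMap.const_apply, hVP, add_zero] at h1 h2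
      rw [← h2]
      exact h1.symm
    refine exists_isPeriodicSol hT hψ (c := c) ?_ u hpq ?_ ?_ ?_ ?_
    · intro x t
      simp only [auxRhs, hper₁ t, hper₂ t]
    · exact fun x y => intervalIntegrable_auxRhs hb₁ hb₂ hG (continuous_iccExtend hpq u) _ _ x y
    · intro t
      rw [hext t, hc]
      congr 1
      refine intervalIntegral.integral_congr fun x hx => ?_
      rw [uIcc_of_le t.2.1] at hx
      have hx' : x ∈ Icc p (p + T) := ⟨hx.1, hx.2.trans t.2.2⟩
      rw [← mul_auxPrim_apply hpq hb₁ hb₂ hG (th s) (al s) u ⟨x, hx'⟩, IccExtend_of_mem _ _ hx',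
        hyA, sub_eq_add_neg]
      rfl
    · rw [hext ⟨p + T, _⟩, hVE, add_zero]
    · have h1 := mul_auxPrim_apply hpq hb₁ hb₂ hG (th s) (al s) u E
      rw [show auxPrim hpq hb₁ hb₂ hG (al s) u E = A s u E from rfl, hAE, mul_zero] at h1
      exact h1.symm
  have hmem : ∀ {s} {u : C(Icc p (p + T), ℝ)} {U Q : ℝ → ℝ},
      IsPeriodicSol T ψ (auxRhs b₁ b₂ G (th s) (al s)) U Q →
      (∀ t : Icc p (p + T), U t = u t) → ∀ t, ∃ t' : Icc p (p + T), U t = u t' := by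
    intro s u U Q hUQ hUu t
    have h1 := toIcoMod_mem_Ico hT p t
    exact ⟨⟨toIcoMod hT p t, h1.1, h1.2.le⟩, by
      rw [← hUu, hUQ.periodic.apply_toIcoMod hT]⟩
  have hevc : ∀ t, Continuous fun z : ℝ × C(Icc p (p + T), ℝ) => z.2 t := fun t =>
    (continuous_eval_const t).comp continuous_snd
  have hforall_le : ∀ c : ℝ, IsClosed {z : ℝ × C(Icc p (p + T), ℝ) | ∀ t, z.2 t ≤ c} := fun c => by
    simp only [Set.ofPred_forall]
    exact isClosed_iInter fun t => isClosed_le (hevc t) continuous_const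
  have hforall_ge : ∀ c : ℝ, IsClosed {z : ℝ × C(Icc p (p + T), ℝ) | ∀ t, c ≤ z.2 t} := fun c => by
    simp only [Set.ofPred_forall]
    exact isClosed_iInter fun t => isClosed_le continuous_const (hevc t)
  have hjoint : Continuous fun w : Icc p (p + T) × (ℝ × C(Icc p (p + T), ℝ)) => w.2.2 w.1 :=
    (continuous_snd.comp continuous_snd).eval continuous_fst
  have hexists_le : ∀ c : ℝ, IsClosed {z : ℝ × C(Icc p (p + T), ℝ) | ∃ t, z.2 t ≤ c} := fun c => by
    convert isClosedMap_snd_of_compactSpace (X := Icc p (p + T)) _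
      (isClosed_le hjoint (continuous_const (y := c))) using 1
    ext z
    simp
  have hexists_ge : ∀ c : ℝ, IsClosed {z : ℝ × C(Icc p (p + T), ℝ) | ∃ t, c ≤ z.2 t} := fun c => by
    convert isClosedMap_snd_of_compactSpace (X := Icc p (p + T)) _
      (isClosed_le (continuous_const (y := c)) hjoint) using 1
    ext z
    simp
  refine not_separated_fixedPoints (b := 3) hHc (isCompact_setOf_bounded_lipschitz _ _ _ _) hHK
    (by norm_num)
    (D := {z | ∀ t, -1 ≤ z.2 t} ∩ {z | ∀ t, z.2 t ≤ R} ∩ ({z | z.1 ≤ 1} ∪ {z | ∀ t, z.2 t ≤ r}))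
    (D' := {z | ∃ t, z.2 t ≤ -1} ∪ {z | ∃ t, R ≤ z.2 t} ∪ ({z | 1 ≤ z.1} ∩ {z | ∃ t, r ≤ z.2 t}))
    (((hforall_ge _).inter (hforall_le _)).inter
      ((isClosed_le continuous_fst continuous_const).union (hforall_le _)))
    (((hexists_le _).union (hexists_ge _)).union
      ((isClosed_le continuous_const continuous_fst).inter (hexists_ge _))) ?_ ?_ ?_ ?_
  · intro z
    by_cases h1 : ∃ t, z.2 t ≤ -1
    · exact Or.inr (Or.inl (Or.inl h1))
    by_cases h2 : ∃ t, R ≤ z.2 t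
    · exact Or.inr (Or.inl (Or.inr h2))
    by_cases h3 : 1 ≤ z.1 ∧ ∃ t, r ≤ z.2 t
    · exact Or.inr (Or.inr h3)
    push Not at h1 h2 h3
    refine Or.inl ⟨⟨fun t => (h1 t).le, fun t => (h2 t).le⟩, ?_⟩
    by_cases h4 : z.1 ≤ 1
    · exact Or.inl h4
    · exact Or.inr fun t => (h3 (not_le.1 h4).le t).le
  · rintro s hs u hu ⟨⟨hD1, hD2⟩, hD3⟩ hD'
    simp only [Set.mem_ofPred_eq] at hD1 hD2
    rcases lt_or_ge s 2 with hs2 | hs2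
    · have hths : 0 < th s := lt_max_of_lt_right (lt_min one_pos (by linarith))
      obtain ⟨U, Q, hUQ, hUu⟩ := hsol s u hu hs2.le hths fun t => ⟨hD1 t, hD2 t⟩
      have hUR : ∀ t, U t ≤ R := fun t => by
        obtain ⟨t', ht'⟩ := hmem hUQ hUu t
        rw [ht']; exact hD2 t'
      have hpos := hnonneg _ _ U Q hths (mul_nonneg hαmax (h01 _).1) hUQ
      have hth1 : s ≤ 1 → th s = 1 := fun h => by
        simp only [hth]
        rw [min_eq_left (by linarith), max_eq_right zero_le_one]
      have hal1 : 1 ≤ s → al s = 0 := fun h => by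
        simp only [hal]
        rw [max_eq_left ((min_le_right _ _).trans (by linarith)), mul_zero]
      rcases hD' with (⟨t, ht⟩ | ⟨t, ht⟩) | ⟨hs1, t, ht⟩
      · have h1 := hpos t
        rw [hUu] at h1
        linarith
      · rw [← hUu] at ht
        rcases hD3 with hs1 | hD3
        · simp only [Set.mem_ofPred_eq] at hs1
          rw [hth1 hs1] at hUQ
          exact absurd ht (not_le.2 (hbound _ U Q (mul_nonneg hαmax (h01 _).1) hUQ hUR t))
        · have h1 := hD3 t
          rw [← hUu] at h1
          linarith
      · rw [← hUu] at ht
        rw [hal1 hs1] at hUQ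
        rcases hD3 with hs1' | hD3
        · rw [hth1 hs1'] at hUQ
          exact absurd ht (not_le.2 (hcon U Q hUQ hUR t))
        · have hUr : ∀ t, U t ≤ r := fun t => by
            obtain ⟨t', ht'⟩ : ∃ t' : Icc p (p + T), U t = u t' := by
              have h1 := toIcoMod_mem_Ico hT p t
              exact ⟨⟨toIcoMod hT p t, h1.1, h1.2.le⟩, by
                rw [← hUu, hUQ.periodic.apply_toIcoMod hT]⟩
            rw [ht']; exact hD3 t'
          exact absurd ht (not_le.2 (hsmall _ U Q hths (h01 _).2 hUQ hUr t))
    · have hths : th s = 0 := max_eq_left ((min_le_right _ _).trans (by linarith))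
      have hals : al s = 0 := by
        simp only [hal]
        rw [max_eq_left ((min_le_right _ _).trans (by linarith)), mul_zero]
      have hy0 : y s u = 0 := by simp only [hy, hths, zero_smul, neg_zero]
      have hconst : ∀ t, u t = u P := fun t => by
        have h1 := DFunLike.congr_fun hu t
        have h2 := DFunLike.congr_fun hu P
        simp only [hH, ContinuousMap.add_apply, ContinuousMap.const_apply, hy0, hV0,
          ContinuousMap.zero_apply] at h1 h2
        exact h1.symm.trans h2
      have hfix := hfixP s u hu
      rw [min_eq_right (hD2 P), max_eq_right (hD1 P)] at hfix
      have hur : ∀ t, u t ≤ r := by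
        rcases hD3 with hs1 | hD3
        · exact absurd hs1 (by simp only [Set.mem_ofPred_eq]; linarith)
        · exact hD3
      have hm_eq : m s u * T = (∫ t in p..p + T, b₁ t) * G (u P) + T * max 0 (min 1 (-(u P))) := by
        have h1 := mul_auxPrim_apply hpq hb₁ hb₂ hG 1 (al s) u E
        rw [one_mul] at h1
        simp only [hm]
        rw [div_mul_cancel₀ _ hT.ne', show A s u E = auxPrim hpq hb₁ hb₂ hG (al s) u E from rfl, h1]
        simp only [auxRhs, hals, IccExtend, Function.comp_apply, hconst, zero_mul, add_zero,
          one_mul]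
        rw [intervalIntegral.integral_add ((hb₁ _ _).mul_const _) intervalIntegrable_const]
        simp [hE]
      have hk := h01 (s - 2)
      change 0 ≤ ka s ∧ ka s ≤ 1 at hk
      rcases hD' with (⟨t, ht⟩ | ⟨t, ht⟩) | ⟨hs1, t, ht⟩
      · rw [hconst] at ht
        have h1 : u P = -1 := le_antisymm ht (hD1 P)
        rw [h1, hG0 (-1) (by norm_num)] at hm_eq
        norm_num at hm_eq
        have h2 : m s u = 1 := mul_right_cancel₀ hT.ne' (by rw [hm_eq, one_mul])
        rw [h1, h2] at hfix
        norm_num at hfix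
      · linarith [hur t]
      · rw [hconst] at ht
        have h1 : u P = r := le_antisymm (hur P) ht
        rw [h1, min_eq_right (by linarith), max_eq_left (by linarith), mul_zero, add_zero] at hm_eq
        have h2 : m s u < 0 := by
          by_contra h
          have h3 := mul_nonneg (not_lt.1 h) hT.le
          rw [hm_eq] at h3
          nlinarith
        rw [h1] at hfix
        rcases hk.2.eq_or_lt with hk1 | hk1
        · rw [hk1, sub_self, zero_mul] at hfix
          linarith
        · nlinarith [mul_pos_of_neg_of_neg h2 (sub_neg.2 hk1), mul_nonneg hk.1 hr.le]
  · rintro u hu ⟨⟨hD1, hD2⟩, hD3⟩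
    have h1 : th 0 = 1 := by simp [hth]
    have h2 : al 0 = αmax := by simp [hal]
    obtain ⟨U, Q, hUQ, hUu⟩ := hsol 0 u hu (by norm_num) (by rw [h1]; exact one_pos)
      fun t => ⟨hD1 t, hD2 t⟩
    have hUR : ∀ t, U t ≤ R := fun t => by
      obtain ⟨t', ht'⟩ := hmem hUQ hUu t
      rw [ht']; exact hD2 t'
    rw [h1, h2] at hUQ
    exact hnone U Q hUQ hUR
  · intro u hu hD'
    have hk : ka 3 = 1 := by simp only [hka]; norm_num
    have hths : th 3 = 0 := by simp only [hth]; norm_num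
    have hu0 : ∀ t, u t = 0 := fun t => by
      have h1 := DFunLike.congr_fun hu t
      simp only [hH, hk, hy, hths, zero_smul, neg_zero, hV0, sub_self, zero_mul,
        ContinuousMap.const_apply, add_zero] at h1
      exact h1.symm
    rcases hD' with (⟨t, ht⟩ | ⟨t, ht⟩) | ⟨-, t, ht⟩
    · rw [hu0] at ht; linarith
    · rw [hu0] at ht; linarith
    · rw [hu0] at ht; linarith

lemma integral_pos_of_ae_pos {a : ℝ → ℝ} {x y : ℝ} (hxy : x < y)
    (ha : IntervalIntegrable a volume x y) (hpos : ∀ᵐ t ∂volume, t ∈ Icc x y → 0 < a t) :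
    0 < ∫ t in x..y, a t := by
  have heq : ∀ᵐ t ∂volume, t ∈ Ioc x y → a t = if 0 < a t then a t else 1 := by
    filter_upwards [hpos] with t ht htm
    rw [if_pos (ht (Ioc_subset_Icc_self htm))]
  rw [intervalIntegral.integral_congr_ae (g := fun t => if 0 < a t then a t else 1)
    (by rwa [uIoc_of_le hxy.le])]
  refine intervalIntegral.intervalIntegral_pos_of_pos_on (ha.congr_ae ?_) (fun t _ => ?_) hxy
  · rw [uIoc_of_le hxy.le, EventuallyEq, ae_restrict_iff' measurableSet_Ioc]
    exact heq
  · split_ifs with h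
    · exact h
    · exact one_pos

section Trajectories

variable {ψ U Q : ℝ → ℝ}

lemma sub_le_mul_of_hasDerivAt_le (hU : ∀ t, HasDerivAt U (ψ (Q t)) t) {x y c : ℝ} (hxy : x ≤ y)
    (hc : ∀ t ∈ Ioo x y, ψ (Q t) ≤ c) : U y - U x ≤ c * (y - x) := by
  have hcont : Continuous U := continuous_iff_continuousAt.2 fun t => (hU t).continuousAt
  refine (convex_Icc x y).image_sub_le_mul_sub_of_deriv_le hcont.continuousOn
    (fun t _ => (hU t).differentiableAt.differentiableWithinAt) ?_ x (left_mem_Icc.2 hxy) y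
    (right_mem_Icc.2 hxy) hxy
  intro t ht
  rw [interior_Icc] at ht
  rw [(hU t).deriv]
  exact hc t ht

lemma mul_le_sub_of_le_hasDerivAt (hU : ∀ t, HasDerivAt U (ψ (Q t)) t) {x y c : ℝ} (hxy : x ≤ y)
    (hc : ∀ t ∈ Ioo x y, c ≤ ψ (Q t)) : c * (y - x) ≤ U y - U x := by
  have hcont : Continuous U := continuous_iff_continuousAt.2 fun t => (hU t).continuousAt
  refine (convex_Icc x y).mul_sub_le_image_sub_of_le_deriv hcont.continuousOn
    (fun t _ => (hU t).differentiableAt.differentiableWithinAt) ?_ x (left_mem_Icc.2 hxy) y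
    (right_mem_Icc.2 hxy) hxy
  intro t ht
  rw [interior_Icc] at ht
  rw [(hU t).deriv]
  exact hc t ht

/-- Where the momentum is nonincreasing, the trajectory lies below its tangents. -/
lemma le_tangent_of_antitoneOn (hU : ∀ t, HasDerivAt U (ψ (Q t)) t) (hψm : StrictMono ψ)
    {x y : ℝ} (hQ : AntitoneOn Q (Icc x y)) {t₁ t₂ : ℝ} (h₁ : t₁ ∈ Icc x y) (h₂ : t₂ ∈ Icc x y) :
    U t₂ ≤ U t₁ + ψ (Q t₁) * (t₂ - t₁) := by
  rcases le_total t₁ t₂ with h | h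
  · have := sub_le_mul_of_hasDerivAt_le hU h (c := ψ (Q t₁)) fun t ht =>
      hψm.monotone (hQ h₁ ⟨h₁.1.trans ht.1.le, ht.2.le.trans h₂.2⟩ ht.1.le)
    linarith
  · have := mul_le_sub_of_le_hasDerivAt hU h (c := ψ (Q t₁)) fun t ht =>
      hψm.monotone (hQ ⟨h₂.1.trans ht.1.le, ht.2.le.trans h₁.2⟩ h₁ ht.2.le)
    linarith

lemma momentum_eq_zero_of_isExtr (hU : ∀ t, HasDerivAt U (ψ (Q t)) t) (hψm : StrictMono ψ)
    (hψ0 : ψ 0 = 0) {t₀ : ℝ} (h : (∀ t, U t ≤ U t₀) ∨ ∀ t, U t₀ ≤ U t) : Q t₀ = 0 := by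
  have hext : IsLocalExtr U t₀ := by
    rcases h with h | h
    · exact Or.inr (Eventually.of_forall h)
    · exact Or.inl (Eventually.of_forall h)
  have h1 := hext.hasDerivAt_eq_zero (hU t₀)
  exact hψm.injective (h1.trans hψ0.symm)

/-- A nonnegative trajectory with nonincreasing momentum and maximum `M` in the right half of
`[x, y]` satisfies quantitative bounds on `[x + δ, x + 2δ]`, where `δ = (y - x) / 4`. -/
lemma momentum_le_of_antitoneOn (hU : ∀ t, HasDerivAt U (ψ (Q t)) t) (hψm : StrictMono ψ)
    {φ : ℝ → ℝ} (hφψ : ∀ s, φ (ψ s) = s) (hφm : StrictMono φ)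
    {x y δ M : ℝ} (hδ : 0 < δ) (hxy : x + δ ≤ y) (hQ : AntitoneOn Q (Icc x y))
    (hUn : ∀ t ∈ Icc x y, 0 ≤ U t) (hUM : ∀ t, U t ≤ M) : Q (x + δ) ≤ φ (M / δ) := by
  have h1 := le_tangent_of_antitoneOn hU hψm hQ (t₁ := x + δ) (t₂ := x) ⟨by linarith, hxy⟩
    ⟨le_rfl, by linarith⟩
  have h2 := hUn x ⟨le_rfl, by linarith⟩
  have h3 : ψ (Q (x + δ)) ≤ M / δ := by
    rw [le_div_iff₀ hδ]
    nlinarith [hUM (x + δ)]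
  rw [← hφψ (Q (x + δ))]
  exact hφm.monotone h3

lemma le_momentum_of_antitoneOn (hU : ∀ t, HasDerivAt U (ψ (Q t)) t) (hψm : StrictMono ψ)
    {φ : ℝ → ℝ} (hφψ : ∀ s, φ (ψ s) = s) (hφm : StrictMono φ)
    {x y δ M : ℝ} (hδ : 0 < δ) (hxy : x ≤ y - δ) (hQ : AntitoneOn Q (Icc x y))
    (hUn : ∀ t ∈ Icc x y, 0 ≤ U t) (hUM : ∀ t, U t ≤ M) : φ (-(M / δ)) ≤ Q (y - δ) := by
  have h1 := le_tangent_of_antitoneOn hU hψm hQ (t₁ := y - δ) (t₂ := y) ⟨hxy, by linarith⟩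
    ⟨by linarith, le_rfl⟩
  have h2 := hUn y ⟨by linarith, le_rfl⟩
  have h3 : -(M / δ) ≤ ψ (Q (y - δ)) := by
    rw [← neg_div, div_le_iff₀ hδ]
    nlinarith [hUM (y - δ)]
  rw [← hφψ (Q (y - δ))]
  exact hφm.monotone h3

end Trajectories

/-- `A priori` bound for the maximum when it is attained in the right half of an interval of
positivity of the weight. -/
lemma exists_bound_of_max_mem_right {φ ψ g a : ℝ → ℝ} (hφm : StrictMono φ) (hψm : StrictMono ψ)
    (hφ0 : φ 0 = 0) (hψ0 : ψ 0 = 0) (hφψ : ∀ s, φ (ψ s) = s)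
    (hσ : ∀ c : ℝ, 1 < c → ∃ C : ℝ, ∀ᶠ s in atTop, φ (c * s) ≤ C * φ s)
    (hg : Continuous g) (hgφ : ∀ K : ℝ, ∀ᶠ s in atTop, K * φ s ≤ g s)
    (ha : ∀ x y, IntervalIntegrable a volume x y) {lam : ℝ} (hlam : 0 < lam) {x y : ℝ}
    (hxy : x < y) (hapos : ∀ᵐ t ∂volume, t ∈ Icc x y → 0 < a t) :
    ∃ R₀ : ℝ, ∀ M, R₀ ≤ M → ∀ U Q : ℝ → ℝ, (∀ t, HasDerivAt U (ψ (Q t)) t) →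
      AntitoneOn Q (Icc x y) → (∀ t, U t ≤ M) → (∀ t ∈ Icc x y, 0 ≤ U t) →
      (∀ t₁ ∈ Icc x y, ∀ t₂ ∈ Icc x y, t₁ ≤ t₂ →
        lam * (∫ t in t₁..t₂, a t * g (U t)) ≤ Q t₁ - Q t₂) →
      ∀ t₀ ∈ Icc ((x + y) / 2) y, U t₀ = M → False := by
  set δ : ℝ := (y - x) / 4 with hδ
  have hδ0 : 0 < δ := by rw [hδ]; linarith
  have hy4 : y = x + 4 * δ := by rw [hδ]; ring
  have haposm : ∀ᵐ t ∂volume.restrict (Icc (x + δ) (x + 2 * δ)), 0 < a t := by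
    rw [ae_restrict_iff' measurableSet_Icc]
    filter_upwards [hapos] with t ht htm
    exact ht ⟨by linarith [htm.1], by linarith [htm.2]⟩
  set I : ℝ := ∫ t in x + δ..x + 2 * δ, a t with hI
  have hI0 : 0 < I := by
    refine integral_pos_of_ae_pos (by linarith) (ha _ _) ?_
    filter_upwards [hapos] with t ht htm
    exact ht ⟨by linarith [htm.1], by linarith [htm.2]⟩
  obtain ⟨C, hC⟩ := hσ (max (4 / δ) 2) (lt_max_of_lt_right one_lt_two)
  have hev := (hC.and ((hgφ ((|C| + 1) / (lam * I))))).and (eventually_gt_atTop 0)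
  obtain ⟨s₀, hs₀⟩ := eventually_atTop.1 hev
  refine ⟨4 * s₀, ?_⟩
  intro M hM U Q hU hQ hUM hUn hineq t₀ ht₀ hUt₀
  have hM4 := hs₀ (M / 4) (by linarith)
  have hMpos : 0 < M := by linarith [hM4.2]
  have hφM : 0 < φ (M / 4) := by rw [← hφ0]; exact hφm hM4.2
  have hQt₀ : Q t₀ = 0 := momentum_eq_zero_of_isExtr hU hψm hψ0 (Or.inl fun t => by
    rw [hUt₀]; exact hUM t)
  have hmem₀ : t₀ ∈ Icc x y := ⟨by linarith [ht₀.1], ht₀.2⟩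
  have hmemδ : x + δ ∈ Icc x y := ⟨by linarith, by linarith⟩
  have hmid : x + 2 * δ ∈ Icc x y := ⟨by linarith, by linarith⟩
  have hQmid : 0 ≤ Q (x + 2 * δ) := by
    rw [← hQt₀]
    exact hQ hmid hmem₀ (by linarith [ht₀.1])
  have hQδ := momentum_le_of_antitoneOn hU hψm hφψ hφm hδ0 (by linarith) hQ hUn hUM
  have hquarter : M / 4 ≤ U (x + δ) := by
    have h1 := le_tangent_of_antitoneOn hU hψm hQ hmemδ (t₂ := x) ⟨le_rfl, hxy.le⟩
    have h2 := hUn x ⟨le_rfl, hxy.le⟩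
    have h3 := le_tangent_of_antitoneOn hU hψm hQ hmemδ hmem₀
    rw [hUt₀] at h3
    have h4 : 0 ≤ ψ (Q (x + δ)) := by
      rw [← hψ0]
      exact hψm.monotone (hQmid.trans (hQ hmemδ hmid (by linarith)))
    have h5 : ψ (Q (x + δ)) * (t₀ - (x + δ)) ≤ ψ (Q (x + δ)) * (3 * δ) :=
      mul_le_mul_of_nonneg_left (by linarith [ht₀.2]) h4
    nlinarith
  have hUge : ∀ t ∈ Icc (x + δ) (x + 2 * δ), M / 4 ≤ U t := by
    intro t ht
    have h1 := mul_le_sub_of_le_hasDerivAt hU ht.1 (c := 0) fun s hs => by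
      rw [← hψ0]
      exact hψm.monotone (hQmid.trans (hQ ⟨by linarith [hs.1], by linarith [hs.2, ht.2]⟩ hmid
        (by linarith [hs.2, ht.2])))
    linarith
  have hUc : Continuous U := continuous_iff_continuousAt.2 fun t => (hU t).continuousAt
  have hIle : (|C| + 1) / (lam * I) * φ (M / 4) * I ≤ ∫ t in x + δ..x + 2 * δ, a t * g (U t) := by
    rw [hI, mul_comm, ← intervalIntegral.integral_mul_const]
    refine intervalIntegral.integral_mono_ae_restrict (by linarith) ((ha _ _).mul_const _)
      ((ha _ _).mul_continuousOn (hg.comp hUc).continuousOn) ?_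
    filter_upwards [haposm, ae_restrict_mem measurableSet_Icc] with t ht htm
    refine mul_le_mul_of_nonneg_left ?_ ht.le
    have h1 := hUge t htm
    refine le_trans ?_ (hs₀ (U t) (by linarith)).1.2
    exact mul_le_mul_of_nonneg_left (hφm.monotone h1) (by positivity)
  have h1 := hineq _ hmemδ _ hmid (by linarith)
  have h2 : φ (M / δ) ≤ |C| * φ (M / 4) := by
    refine (hφm.monotone ?_).trans (hM4.1.1.trans
      (mul_le_mul_of_nonneg_right (le_abs_self C) hφM.le))
    calc M / δ = 4 / δ * (M / 4) := by field_simp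
      _ ≤ _ := mul_le_mul_of_nonneg_right (le_max_left _ _) hM4.2.le
  have h3 := mul_le_mul_of_nonneg_left hIle hlam.le
  have h4 : lam * ((|C| + 1) / (lam * I) * φ (M / 4) * I) = (|C| + 1) * φ (M / 4) := by
    field_simp
  linarith

/-- `A priori` bound for the maximum when it is attained in an interval of positivity of the
weight. -/
lemma exists_bound_of_max_mem {φ ψ g a : ℝ → ℝ} (hφm : StrictMono φ) (hψm : StrictMono ψ)
    (hφ0 : φ 0 = 0) (hψ0 : ψ 0 = 0) (hφψ : ∀ s, φ (ψ s) = s)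
    (hσ : ∀ c : ℝ, 1 < c → ∃ C : ℝ, ∀ᶠ s in atTop, φ (c * s) ≤ C * φ s)
    (hσ' : ∀ c : ℝ, 1 < c → ∃ C : ℝ, ∀ᶠ s in atTop, -φ (-(c * s)) ≤ C * -φ (-s))
    (hg : Continuous g) (hgφ : ∀ K : ℝ, ∀ᶠ s in atTop, K * φ s ≤ g s)
    (hgφ' : ∀ K : ℝ, ∀ᶠ s in atTop, K * -φ (-s) ≤ g s)
    (ha : ∀ x y, IntervalIntegrable a volume x y) {lam : ℝ} (hlam : 0 < lam) {x y : ℝ}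
    (hxy : x < y) (hapos : ∀ᵐ t ∂volume, t ∈ Icc x y → 0 < a t) :
    ∃ R₀ : ℝ, ∀ M, R₀ ≤ M → ∀ U Q : ℝ → ℝ, (∀ t, HasDerivAt U (ψ (Q t)) t) →
      AntitoneOn Q (Icc x y) → (∀ t, U t ≤ M) → (∀ t ∈ Icc x y, 0 ≤ U t) →
      (∀ t₁ ∈ Icc x y, ∀ t₂ ∈ Icc x y, t₁ ≤ t₂ →
        lam * (∫ t in t₁..t₂, a t * g (U t)) ≤ Q t₁ - Q t₂) →
      ∀ t₀ ∈ Icc x y, U t₀ = M → False := by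
  obtain ⟨R₁, hR₁⟩ := exists_bound_of_max_mem_right hφm hψm hφ0 hψ0 hφψ hσ hg hgφ ha hlam hxy hapos
  have hneg : MeasurePreserving (fun t : ℝ => -t) volume volume := Measure.measurePreserving_neg _
  obtain ⟨R₂, hR₂⟩ := exists_bound_of_max_mem_right (φ := fun s => -φ (-s)) (ψ := fun s => -ψ (-s))
    (g := g) (a := fun t => a (-t)) (x := -y) (y := -x)
    (fun s t hst => neg_lt_neg (hφm (neg_lt_neg hst)))
    (fun s t hst => neg_lt_neg (hψm (neg_lt_neg hst))) (by simp [hφ0]) (by simp [hψ0])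
    (fun s => by simp [hφψ]) hσ' hg hgφ' (fun s t => by
      simpa using (IntervalIntegrable.iff_comp_neg (f := a) (a := -s) (b := -t)).1 (ha _ _))
    hlam (neg_lt_neg hxy) (by
      filter_upwards [hneg.quasiMeasurePreserving.ae hapos] with t ht htm
      exact ht ⟨by linarith [htm.2], by linarith [htm.1]⟩)
  refine ⟨max R₁ R₂, fun M hM U Q hU hQ hUM hUn hineq t₀ ht₀ hUt₀ => ?_⟩
  rcases le_total ((x + y) / 2) t₀ with h | h
  · exact hR₁ M ((le_max_left _ _).trans hM) U Q hU hQ hUM hUn hineq t₀ ⟨h, ht₀.2⟩ hUt₀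
  · have hflip : ∀ {t : ℝ}, t ∈ Icc (-y) (-x) → -t ∈ Icc x y := fun ht =>
      ⟨by linarith [ht.2], by linarith [ht.1]⟩
    refine hR₂ M ((le_max_right _ _).trans hM) (fun t => U (-t)) (fun t => -Q (-t)) (fun t => ?_)
      (fun s hs t ht hst => neg_le_neg (hQ (hflip ht) (hflip hs) (neg_le_neg hst)))
      (fun t => hUM _) (fun t ht => hUn _ (hflip ht)) (fun t₁ h₁ t₂ h₂ h₁₂ => ?_) (-t₀)
      ⟨by linarith, by linarith [ht₀.1]⟩ (by simpa using hUt₀)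
    · simpa [Function.comp_def] using (hU (-t)).scomp t (hasDerivAt_neg t)
    · have h1 := hineq _ (hflip h₂) _ (hflip h₁) (neg_le_neg h₁₂)
      have h2 := intervalIntegral.integral_comp_neg (fun t => a t * g (U t)) (a := t₁) (b := t₂)
      rw [h2]
      linarith

namespace IsPeriodicSol

variable {T : ℝ} {ψ U Q : ℝ → ℝ} {f : ℝ → ℝ → ℝ}

lemma continuous (h : IsPeriodicSol T ψ f U Q) : Continuous U :=
  continuous_iff_continuousAt.2 fun t => (h.hasDerivAt t).continuousAt

lemma integral_eq_zero (h : IsPeriodicSol T ψ f U Q) (x : ℝ) : ∫ t in x..x + T, f t (U t) = 0 := by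
  have h1 := h.sub_eq x (x + T)
  rw [h.periodic_momentum x] at h1
  linarith

lemma exists_forall_ge (h : IsPeriodicSol T ψ f U Q) (hT : 0 < T) (p : ℝ) :
    ∃ t₀ ∈ Ico p (p + T), ∀ t, U t ≤ U t₀ := by
  obtain ⟨t₀, -, h₀⟩ := (isCompact_Icc (a := p) (b := p + T)).exists_isMaxOn
    (nonempty_Icc.2 (by linarith)) h.continuous.continuousOn
  refine ⟨toIcoMod hT p t₀, toIcoMod_mem_Ico hT p t₀, fun t => ?_⟩
  rw [h.periodic.apply_toIcoMod hT, ← h.periodic.apply_toIcoMod hT p t]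
  exact h₀ (Ico_subset_Icc_self (toIcoMod_mem_Ico hT p t))

lemma exists_forall_le (h : IsPeriodicSol T ψ f U Q) (hT : 0 < T) :
    ∃ t₀, ∀ t, U t₀ ≤ U t := by
  obtain ⟨t₀, -, h₀⟩ := (isCompact_Icc (a := 0) (b := T)).exists_isMinOn
    (nonempty_Icc.2 hT.le) h.continuous.continuousOn
  refine ⟨t₀, fun t => ?_⟩
  rw [← h.periodic.apply_toIcoMod hT 0 t]
  have h1 := toIcoMod_mem_Ico hT 0 t
  rw [zero_add] at h1
  exact h₀ (Ico_subset_Icc_self h1)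

/-- Solutions of the auxiliary problems are nonnegative. -/
lemma nonneg {b₁ b₂ G : ℝ → ℝ} {ϑ α : ℝ} (h : IsPeriodicSol T ψ (auxRhs b₁ b₂ G ϑ α) U Q)
    (hT : 0 < T) (hψm : StrictMono ψ) (hψ0 : ψ 0 = 0) (hG0 : ∀ x ≤ 0, G x = 0)
    (hb₂ : ∀ t, 0 ≤ b₂ t) (hϑ : 0 < ϑ) (hα : 0 ≤ α) (t : ℝ) : 0 ≤ U t := by
  obtain ⟨s, hs⟩ := h.exists_forall_le hT
  refine le_trans ?_ (hs t)
  by_contra hneg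
  rw [not_le] at hneg
  have hpos : ∀ t, U t < 0 → 0 < auxRhs b₁ b₂ G ϑ α t (U t) := fun t ht => by
    have h1 := lt_max_of_lt_right (b := (0 : ℝ)) (lt_min one_pos (neg_pos.2 ht))
    have h2 := mul_nonneg hα (hb₂ t)
    rw [auxRhs, hG0 _ ht.le, mul_zero, zero_add]
    exact mul_pos hϑ (add_pos_of_pos_of_nonneg h1 h2)
  have hQs := momentum_eq_zero_of_isExtr h.hasDerivAt hψm hψ0 (Or.inr hs)
  by_cases hex : ∃ t, 0 ≤ U t
  · obtain ⟨t₁, ht₁⟩ := hex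
    rw [← h.periodic.apply_toIcoMod hT s t₁] at ht₁
    have hmem := toIcoMod_mem_Ico hT s t₁
    obtain ⟨t₀, ⟨ht₀, hUt₀⟩, hleast⟩ := ((isCompact_Icc (a := s) (b := s + T)).inter_right
      (isClosed_le continuous_const h.continuous)).exists_isLeast
      ⟨toIcoMod hT s t₁, Ico_subset_Icc_self hmem, ht₁⟩
    have h1 := sub_le_mul_of_hasDerivAt_le h.hasDerivAt ht₀.1 (c := 0) fun x hx => by
      rw [← hψ0]
      refine hψm.monotone ?_
      have h2 := h.sub_eq s x
      have h3 : 0 ≤ ∫ y in s..x, auxRhs b₁ b₂ G ϑ α y (U y) := by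
        refine intervalIntegral.integral_nonneg hx.1.le fun y hy => (hpos y ?_).le
        by_contra hy0
        have := hleast ⟨⟨hy.1, hy.2.trans (hx.2.le.trans ht₀.2)⟩, not_lt.1 hy0⟩
        linarith [hy.2, hx.2]
      linarith
    have hUt₀' : (0 : ℝ) ≤ U t₀ := hUt₀
    linarith
  · push Not at hex
    have h1 := intervalIntegral.intervalIntegral_pos_of_pos_on (h.intervalIntegrable 0 (0 + T))
      (fun x _ => hpos x (hex x)) (by linarith)
    rw [h.integral_eq_zero] at h1
    exact lt_irrefl _ h1

/-- If `f(t, U) ≤ 0` outside a closed set containing the starting point of a period, then the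
maximum of `U` is attained in this set. -/
lemma exists_forall_ge_mem (h : IsPeriodicSol T ψ f U Q) (hT : 0 < T) (hψm : StrictMono ψ)
    (hψ0 : ψ 0 = 0) {p : ℝ} {S : Set ℝ} (hS : IsClosed S) (hpS : p ∈ S)
    (hf : ∀ᵐ t ∂volume, t ∈ Ico p (p + T) \ S → f t (U t) ≤ 0) :
    ∃ t₀ ∈ S, ∀ t, U t ≤ U t₀ := by
  obtain ⟨s, hs, hmax⟩ := h.exists_forall_ge hT p
  have hQs := momentum_eq_zero_of_isExtr h.hasDerivAt hψm hψ0 (Or.inl hmax)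
  obtain ⟨t₀, ⟨ht₀, hS₀⟩, hleast⟩ := ((isCompact_Icc (a := s) (b := p + T)).inter_right
    (hS.union isClosed_singleton)).exists_isLeast (s := _ ∩ (S ∪ {p + T}))
      ⟨p + T, ⟨hs.2.le, le_rfl⟩, Or.inr rfl⟩
  have h1 := mul_le_sub_of_le_hasDerivAt h.hasDerivAt ht₀.1 (c := 0) fun x hx => by
    rw [← hψ0]
    refine hψm.monotone ?_
    have h2 := h.sub_eq s x
    have h3 : 0 ≤ ∫ y in s..x, -f y (U y) := by
      refine intervalIntegral.integral_nonneg_of_ae_restrict hx.1.le ?_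
      rw [EventuallyLE, ae_restrict_iff' measurableSet_Icc]
      filter_upwards [hf] with y hy hym
      refine neg_nonneg.2 (hy ⟨⟨hs.1.trans hym.1, by linarith [hym.2, hx.2, ht₀.2]⟩, fun hyS => ?_⟩)
      have := hleast ⟨⟨hym.1, by linarith [hym.2, hx.2, ht₀.2]⟩, Or.inl hyS⟩
      linarith [hym.2, hx.2]
    rw [intervalIntegral.integral_neg] at h3
    linarith
  rcases hS₀ with hS₀ | rfl
  · exact ⟨t₀, hS₀, fun t => (hmax t).trans (by linarith)⟩
  · refine ⟨p, hpS, fun t => (hmax t).trans ?_⟩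
    rw [h.periodic p] at h1
    linarith

/-- Solutions of the auxiliary problem without forcing grow slowly after a critical point, as long
as they remain small. -/
lemma le_of_small {b₁ b₂ G φ : ℝ → ℝ} {ϑ : ℝ} (h : IsPeriodicSol T ψ (auxRhs b₁ b₂ G ϑ 0) U Q)
    (hb₁ : ∀ x y, IntervalIntegrable b₁ volume x y) (hper : Function.Periodic b₁ T)
    (hψm : StrictMono ψ) (hψφ : ∀ s, ψ (φ s) = s) (hGn : ∀ x, 0 ≤ G x)
    (hU : ∀ t, 0 ≤ U t)
    (hϑ : 0 < ϑ) (hϑ1 : ϑ ≤ 1) {t₀ t B e : ℝ} (ht : t ∈ Icc t₀ (t₀ + T)) (hQ : Q t₀ = 0)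
    (hB : 0 ≤ B) (hGB : ∀ s ∈ Icc t₀ t, G (U s) ≤ B)
    (he : (∫ s in (0 : ℝ)..T, |b₁ s|) * B ≤ φ e) :
    ψ (Q t) ≤ e := by
  rw [← hψφ e]
  refine hψm.monotone (le_trans ?_ he)
  have h1 := h.sub_eq t₀ t
  have hint : IntervalIntegrable (fun s => -auxRhs b₁ b₂ G ϑ 0 s (U s)) volume t₀ t :=
    (h.intervalIntegrable t₀ t).neg
  have h2 : ∫ s in t₀..t, -auxRhs b₁ b₂ G ϑ 0 s (U s) ≤ ∫ s in t₀..t, |b₁ s| * B := by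
    refine intervalIntegral.integral_mono_on ht.1 hint ((hb₁ _ _).abs.mul_const B) fun s hs => ?_
    rw [auxRhs, min_eq_right (by linarith [hU s]), max_eq_left (by linarith [hU s]), zero_mul,
      add_zero, add_zero]
    have h3 : |ϑ * (b₁ s * G (U s))| ≤ |b₁ s| * B := by
      rw [abs_mul, abs_mul, abs_of_pos hϑ, abs_of_nonneg (hGn _)]
      have h4 := mul_le_mul_of_nonneg_left (hGB s hs) (abs_nonneg (b₁ s))
      exact (mul_le_of_le_one_left (mul_nonneg (abs_nonneg _) (hGn _)) hϑ1).trans h4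
    exact (neg_le_abs _).trans h3
  have h3 : ∫ s in t₀..t, |b₁ s| ≤ ∫ s in (0 : ℝ)..T, |b₁ s| := by
    have h4 : Function.Periodic (fun s => |b₁ s|) T := fun s => by simp only [hper s]
    have h5 := h4.intervalIntegral_add_eq 0 t₀
    rw [zero_add] at h5
    rw [h5]
    exact intervalIntegral.integral_mono_interval le_rfl ht.1 ht.2
      (Eventually.of_forall fun s => abs_nonneg _) (hb₁ _ _).abs
  rw [intervalIntegral.integral_neg, intervalIntegral.integral_mul_const] at h2
  have h4 := mul_le_mul_of_nonneg_right h3 hB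
  linarith

end IsPeriodicSol

/-- Near zero, `g` is negligible with respect to `φ(ε ·)`. -/
lemma exists_forall_mul_le_of_small {φ g : ℝ → ℝ} (hφm : StrictMono φ) (hφ0 : φ 0 = 0)
    (hσ : ∀ c : ℝ, 1 < c → ∃ C : ℝ, ∀ᶠ s in nhdsWithin 0 (Ioi (0 : ℝ)), φ (c * s) ≤ C * φ s)
    (hg0 : g 0 = 0) (hgφ : ∀ e : ℝ, 0 < e → ∀ᶠ s in nhdsWithin 0 (Ioi (0 : ℝ)), g s ≤ e * φ s)
    {K ε : ℝ} (hK : 0 < K) (hε : 0 < ε) :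
    ∃ r₀ > 0, ∀ r, 0 < r → r ≤ r₀ → ∀ s ∈ Icc 0 r, K * g s ≤ φ (ε * r) := by
  obtain ⟨C, hC⟩ := hσ (max (1 / ε) 2) (lt_max_of_lt_right one_lt_two)
  set C' := max C 1 with hC'
  have hC'0 : 0 < C' := lt_max_of_lt_right one_pos
  have h1 := hgφ (1 / (K * C')) (by positivity)
  obtain ⟨d₁, hd₁, hd₁'⟩ := mem_nhdsGT_iff_exists_Ioo_subset.1 hC
  obtain ⟨d₂, hd₂, hd₂'⟩ := mem_nhdsGT_iff_exists_Ioo_subset.1 h1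
  rw [mem_Ioi] at hd₁ hd₂
  refine ⟨min (d₂ / 2) (d₁ / (2 * ε)), by positivity, fun r hr hrr s hs => ?_⟩
  have hr₂ : r < d₂ := by linarith [hrr.trans (min_le_left _ _)]
  have hr₁ : ε * r < d₁ := by
    have := hrr.trans (min_le_right _ _)
    rw [le_div_iff₀ (by positivity)] at this
    nlinarith
  have hεr : 0 < ε * r := by positivity
  have hφεr : 0 < φ (ε * r) := by rw [← hφ0]; exact hφm hεr
  rcases hs.1.eq_or_lt with rfl | hs0
  · rw [hg0, mul_zero]; exact hφεr.le
  · have h2 : g s ≤ 1 / (K * C') * φ s := hd₂' ⟨hs0, hs.2.trans_lt hr₂⟩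
    have h3 : φ (max (1 / ε) 2 * (ε * r)) ≤ C * φ (ε * r) := hd₁' ⟨hεr, hr₁⟩
    have h4 : φ s ≤ φ (max (1 / ε) 2 * (ε * r)) := by
      refine hφm.monotone (hs.2.trans ?_)
      calc r = 1 / ε * (ε * r) := by field_simp
        _ ≤ _ := mul_le_mul_of_nonneg_right (le_max_left _ _) hεr.le
    have h5 : φ s ≤ C' * φ (ε * r) :=
      h4.trans (h3.trans (mul_le_mul_of_nonneg_right (le_max_left _ _) hφεr.le))
    calc K * g s ≤ K * (1 / (K * C') * φ s) := mul_le_mul_of_nonneg_left h2 hK.le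
      _ ≤ K * (1 / (K * C') * (C' * φ (ε * r))) := by gcongr
      _ = φ (ε * r) := by field_simp

lemma RegOscZero.exists_abs_sub_le {g : ℝ → ℝ} (hreg : RegOscZero g)
    (hgpos : ∀ s, 0 < s → 0 < g s) {δ : ℝ} (hδ : 0 < δ) :
    ∃ η > 0, ∃ s₀ > 0, ∀ ω s, |ω - 1| < η → 0 < s → s < s₀ → |g (ω * s) - g s| ≤ δ * g s := by
  have h1 := Metric.tendsto_nhds.1 hreg δ hδ
  obtain ⟨P₁, hP₁, P₂, hP₂, h2⟩ := eventually_prod_iff.1 h1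
  obtain ⟨η, hη, hη'⟩ := Metric.eventually_nhds_iff.1 hP₁
  obtain ⟨s₀, hs₀, hs₀'⟩ := mem_nhdsGT_iff_exists_Ioo_subset.1 hP₂
  refine ⟨η, hη, s₀, hs₀, fun ω s hω hs hss => ?_⟩
  have h3 := h2 (hη' (by rwa [Real.dist_eq])) (hs₀' ⟨hs, hss⟩)
  simp only [Real.dist_eq] at h3
  have hgs := hgpos s hs
  have h4 : g (ω * s) - g s = (g (ω * s) / g s - 1) * g s := by field_simp
  rw [h4, abs_mul, abs_of_pos hgs]
  exact mul_le_mul_of_nonneg_right h3.le hgs.le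

namespace IsPeriodicSol

/-- Nontrivial solutions with small maximum do not exist when the weight has negative mean. -/
lemma exists_forall_lt_of_small {T : ℝ} {ψ φ b₁ b₂ g : ℝ → ℝ} (hT : 0 < T)
    (hb₁ : ∀ x y, IntervalIntegrable b₁ volume x y) (hper : Function.Periodic b₁ T)
    (hneg : ∫ t in (0 : ℝ)..T, b₁ t < 0)
    (hψm : StrictMono ψ) (hψ0 : ψ 0 = 0) (hψφ : ∀ s, ψ (φ s) = s)
    (hgpos : ∀ s, 0 < s → 0 < g s)
    (hreg : ∀ δ > 0, ∃ η > 0, ∃ s₀ > 0, ∀ ω s, |ω - 1| < η → 0 < s → s < s₀ →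
      |g (ω * s) - g s| ≤ δ * g s)
    (hsm : ∀ ε > 0, ∃ r₀ > 0, ∀ r, 0 < r → r ≤ r₀ → ∀ s ∈ Icc 0 r,
      (∫ t in (0 : ℝ)..T, |b₁ t|) * g s ≤ φ (ε * r)) :
    ∃ r₁ > 0, ∀ r, 0 < r → r ≤ r₁ → ∀ G : ℝ → ℝ, (∀ x, 0 ≤ G x) → (∀ x ≤ r, G x = g x) →
      ∀ ϑ U Q, 0 < ϑ → ϑ ≤ 1 → IsPeriodicSol T ψ (auxRhs b₁ b₂ G ϑ 0) U Q → (∀ t, 0 ≤ U t) →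
      (∀ t, U t ≤ r) → ∀ t, U t < r := by
  set K := ∫ t in (0 : ℝ)..T, |b₁ t| with hKdef
  have hK : 0 < K := by
    have h1 := intervalIntegral.abs_integral_le_integral_abs (f := b₁) (μ := volume) hT.le
    have h2 := abs_pos.2 hneg.ne
    linarith
  obtain ⟨η, hη, s₀, hs₀, hosc⟩ := hreg (-(∫ t in (0 : ℝ)..T, b₁ t) / (2 * K))
    (div_pos (neg_pos.2 hneg) (by positivity))
  obtain ⟨r₀, hr₀, hr₀'⟩ := hsm (η / (2 * T)) (by positivity)
  refine ⟨min r₀ (s₀ / 2), by positivity, ?_⟩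
  intro r hr hrr G hGn hGg ϑ U Q hϑ hϑ1 h hU hUr t
  by_contra hlt
  have hUt : U t = r := le_antisymm (hUr t) (not_lt.1 hlt)
  have hQt := momentum_eq_zero_of_isExtr h.hasDerivAt hψm hψ0
    (Or.inl fun s => (hUr s).trans hUt.ge)
  have hgr := hgpos r hr
  have hsmr := hr₀' r hr (hrr.trans (min_le_left _ _))
  have hB0 : 0 ≤ φ (η / (2 * T) * r) :=
    (mul_pos hK hgr).le.trans (hsmr r ⟨hr.le, le_rfl⟩)
  have hψQ : ∀ s ∈ Icc t (t + T), ψ (Q s) ≤ η / (2 * T) * r := fun s hs =>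
    h.le_of_small hb₁ hper hψm hψφ hGn hU hϑ hϑ1 hs hQt (div_nonneg hB0 hK.le)
      (fun x _ => by
        rw [le_div_iff₀ hK, mul_comm, hGg _ (hUr x)]
        exact hsmr _ ⟨hU x, hUr x⟩)
      (by rw [mul_div_cancel₀ _ hK.ne'])
  have hclose : ∀ s ∈ Icc t (t + T), |U s / r - 1| < η := by
    intro s hs
    have h1 := sub_le_mul_of_hasDerivAt_le h.hasDerivAt hs.2
      (c := η / (2 * T) * r) fun x hx => hψQ x ⟨hs.1.trans hx.1.le, hx.2.le⟩
    rw [h.periodic t, hUt] at h1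
    have h2 : η / (2 * T) * r * (t + T - s) ≤ η / (2 * T) * r * T :=
      mul_le_mul_of_nonneg_left (by linarith [hs.1]) (by positivity)
    have h3 : η / (2 * T) * r * T = η / 2 * r := by field_simp
    rw [div_sub_one hr.ne', abs_div, abs_of_pos hr, div_lt_iff₀ hr, abs_lt]
    constructor
    · nlinarith
    · nlinarith [hUr s]
  set δ := -(∫ t in (0 : ℝ)..T, b₁ t) / (2 * K) with hδ
  have hosc' : ∀ s ∈ Icc t (t + T), |G (U s) - g r| ≤ δ * g r := by
    intro s hs
    have h1 := hosc _ r (hclose s hs) hr (by linarith [hrr.trans (min_le_right _ _)])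
    rw [div_mul_cancel₀ _ hr.ne'] at h1
    rwa [hGg _ (hUr s)]
  have hle : t ≤ t + T := by linarith
  have h1 : ∫ s in t..t + T, auxRhs b₁ b₂ G ϑ 0 s (U s) ≤
      ∫ s in t..t + T, ϑ * (b₁ s * g r + |b₁ s| * (δ * g r)) := by
    refine intervalIntegral.integral_mono_on hle (h.intervalIntegrable _ _)
      ((((hb₁ _ _).mul_const _).add ((hb₁ _ _).abs.mul_const _)).const_mul ϑ) fun s hs => ?_
    rw [auxRhs, min_eq_right (by linarith [hU s]), max_eq_left (by linarith [hU s]), zero_mul,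
      add_zero, add_zero]
    refine mul_le_mul_of_nonneg_left ?_ hϑ.le
    have h2 : b₁ s * (G (U s) - g r) ≤ |b₁ s| * (δ * g r) := by
      refine (le_abs_self _).trans ?_
      rw [abs_mul]
      exact mul_le_mul_of_nonneg_left (hosc' s hs) (abs_nonneg _)
    linarith
  rw [h.integral_eq_zero, intervalIntegral.integral_const_mul,
    intervalIntegral.integral_add ((hb₁ _ _).mul_const _) ((hb₁ _ _).abs.mul_const _),
    intervalIntegral.integral_mul_const, intervalIntegral.integral_mul_const,
    hper.intervalIntegral_add_eq t 0,
    (show Function.Periodic (fun s => |b₁ s|) T from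
      fun s => by simp only [hper s]).intervalIntegral_add_eq t 0, zero_add, ← hKdef] at h1
  have h2 : K * (δ * g r) = -(∫ t in (0 : ℝ)..T, b₁ t) / 2 * g r := by
    rw [hδ]; field_simp
  rw [h2] at h1
  have h3 : (∫ t in (0 : ℝ)..T, b₁ t) * g r < 0 := mul_neg_of_neg_of_pos hneg hgr
  nlinarith [mul_neg_of_pos_of_neg hϑ h3]

/-- A nonnegative solution which is not small is positive. -/
lemma pos_of_not_small {T : ℝ} {ψ φ b₁ b₂ G U Q : ℝ → ℝ} (hT : 0 < T)
    (h : IsPeriodicSol T ψ (auxRhs b₁ b₂ G 1 0) U Q)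
    (hb₁ : ∀ x y, IntervalIntegrable b₁ volume x y) (hper : Function.Periodic b₁ T)
    (hK : 0 < ∫ t in (0 : ℝ)..T, |b₁ t|)
    (hψm : StrictMono ψ) (hψ0 : ψ 0 = 0) (hψφ : ∀ s, ψ (φ s) = s) (hGn : ∀ x, 0 ≤ G x)
    {r : ℝ} (hr : 0 < r) (hsm : ∀ s ∈ Icc 0 r,
      (∫ t in (0 : ℝ)..T, |b₁ t|) * G s ≤ φ (1 / (2 * T) * r))
    (hU : ∀ t, 0 ≤ U t) (hUr : ∃ t, r ≤ U t) (t : ℝ) : 0 < U t := by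
  refine (hU t).lt_of_ne' fun hUt => ?_
  have hQt := momentum_eq_zero_of_isExtr h.hasDerivAt hψm hψ0
    (Or.inr fun s => hUt.le.trans (hU s))
  obtain ⟨t₁, ht₁⟩ := hUr
  rw [← h.periodic.apply_toIcoMod hT t t₁] at ht₁
  have hmem := toIcoMod_mem_Ico hT t t₁
  obtain ⟨t₀, ⟨ht₀, hUt₀⟩, hleast⟩ := ((isCompact_Icc (a := t) (b := t + T)).inter_right
    (isClosed_le continuous_const h.continuous)).exists_isLeast
    ⟨toIcoMod hT t t₁, Ico_subset_Icc_self hmem, ht₁⟩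
  have hB0 : 0 ≤ φ (1 / (2 * T) * r) :=
    (mul_nonneg hK.le (hGn r)).trans (hsm r ⟨hr.le, le_rfl⟩)
  have h1 := sub_le_mul_of_hasDerivAt_le h.hasDerivAt ht₀.1 (c := 1 / (2 * T) * r) fun x hx =>
    h.le_of_small hb₁ hper hψm hψφ hGn hU one_pos le_rfl ⟨hx.1.le, hx.2.le.trans ht₀.2⟩ hQt
      (div_nonneg hB0 hK.le) (fun y hy => by
        rw [le_div_iff₀ hK, mul_comm]
        refine hsm _ ⟨hU y, ?_⟩
        by_contra hy0
        have := hleast ⟨⟨hy.1, hy.2.trans (hx.2.le.trans ht₀.2)⟩, (not_le.1 hy0).le⟩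
        linarith [hy.2, hx.2])
      (by rw [mul_div_cancel₀ _ hK.ne'])
  have hUt₀' : r ≤ U t₀ := hUt₀
  have h2 : 1 / (2 * T) * r * (t₀ - t) ≤ 1 / (2 * T) * r * T :=
    mul_le_mul_of_nonneg_left (by linarith [ht₀.2]) (by positivity)
  have h3 : 1 / (2 * T) * r * T = r / 2 := by field_simp
  linarith

end IsPeriodicSol

lemma IsPeriodicSol.integral_add_le_momentum_sub {T : ℝ} {ψ a G U Q : ℝ → ℝ} {lam α : ℝ}
    (h : IsPeriodicSol T ψ (auxRhs (fun t => lam * a t) (fun t => max (a t) 0) G 1 α) U Q)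
    (ha : ∀ x y, IntervalIntegrable a volume x y) (hG : Continuous G) (hα : 0 ≤ α) {t₁ t₂ : ℝ}
    (h₁₂ : t₁ ≤ t₂) :
    lam * (∫ t in t₁..t₂, a t * G (U t)) + α * (∫ t in t₁..t₂, a t) ≤ Q t₁ - Q t₂ := by
  have h1 := h.sub_eq t₁ t₂
  have h2 : IntervalIntegrable (fun t => a t * G (U t)) volume t₁ t₂ :=
    (ha _ _).mul_continuousOn (hG.comp h.continuous).continuousOn
  rw [← intervalIntegral.integral_const_mul, ← intervalIntegral.integral_const_mul,
    ← intervalIntegral.integral_add (h2.const_mul _) ((ha _ _).const_mul _)]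
  have h3 : ∫ t in t₁..t₂, (lam * (a t * G (U t)) + α * a t) ≤
      ∫ t in t₁..t₂, auxRhs (fun t => lam * a t) (fun t => max (a t) 0) G 1 α t (U t) := by
    refine intervalIntegral.integral_mono_on h₁₂ ((h2.const_mul _).add ((ha _ _).const_mul _))
      (h.intervalIntegrable _ _) fun t _ => ?_
    simp only [auxRhs]
    have h4 := mul_le_mul_of_nonneg_left (le_max_left (a t) 0) hα
    have h5 := le_max_left 0 (min 1 (-(U t)))
    nlinarith
  linarith

lemma integral_nonneg_of_mem_Icc {a G : ℝ → ℝ} {x y t₁ t₂ : ℝ}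
    (hapos : ∀ᵐ t ∂volume, t ∈ Icc x y → 0 < a t) (hG : ∀ t, 0 ≤ G t)
    (h₁ : t₁ ∈ Icc x y) (h₂ : t₂ ∈ Icc x y) (h₁₂ : t₁ ≤ t₂) : 0 ≤ ∫ t in t₁..t₂, a t * G t := by
  refine intervalIntegral.integral_nonneg_of_ae_restrict h₁₂ ?_
  rw [EventuallyLE, ae_restrict_iff' measurableSet_Icc]
  filter_upwards [hapos] with t ht htm
  exact mul_nonneg (ht ⟨h₁.1.trans htm.1, htm.2.trans h₂.2⟩).le (hG t)

lemma IsPeriodicSol.antitoneOn_momentum {T : ℝ} {ψ a G U Q : ℝ → ℝ} {lam α : ℝ}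
    (h : IsPeriodicSol T ψ (auxRhs (fun t => lam * a t) (fun t => max (a t) 0) G 1 α) U Q)
    (ha : ∀ x y, IntervalIntegrable a volume x y) (hG : Continuous G) (hGn : ∀ x, 0 ≤ G x)
    (hlam : 0 < lam) (hα : 0 ≤ α) {x y : ℝ} (hapos : ∀ᵐ t ∂volume, t ∈ Icc x y → 0 < a t) :
    AntitoneOn Q (Icc x y) := by
  intro t₁ h₁ t₂ h₂ h₁₂
  have h1 := h.integral_add_le_momentum_sub ha hG hα h₁₂
  have h2 := mul_nonneg hlam.le (integral_nonneg_of_mem_Icc hapos (fun t => hGn (U t)) h₁ h₂ h₁₂)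
  have h3 := mul_nonneg hα (integral_nonneg_of_mem_Icc hapos (fun _ => zero_le_one) h₁ h₂ h₁₂)
  simp only [mul_one] at h3
  linarith

/-- For a large forcing term there are no solutions bounded by `R`. -/
lemma exists_forcing_of_bound {T : ℝ} {φ ψ a G : ℝ → ℝ} (hφm : StrictMono φ) (hψm : StrictMono ψ)
    (hφψ : ∀ s, φ (ψ s) = s) (ha : ∀ x y, IntervalIntegrable a volume x y)
    (hG : Continuous G) (hGn : ∀ x, 0 ≤ G x) {lam : ℝ} (hlam : 0 < lam) {x y R : ℝ} (hxy : x < y)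
    (hR : 0 ≤ R) (hapos : ∀ᵐ t ∂volume, t ∈ Icc x y → 0 < a t) :
    ∃ α : ℝ, 0 ≤ α ∧ ∀ U Q,
      IsPeriodicSol T ψ (auxRhs (fun t => lam * a t) (fun t => max (a t) 0) G 1 α) U Q →
      (∀ t, 0 ≤ U t) → (∀ t, U t ≤ R) → False := by
  set δ : ℝ := (y - x) / 4 with hδ
  have hδ0 : 0 < δ := by rw [hδ]; linarith
  have hy4 : y = x + 4 * δ := by rw [hδ]; ring
  have hI : 0 < ∫ t in x + δ..y - δ, a t := by
    refine integral_pos_of_ae_pos (by linarith) (ha _ _) ?_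
    filter_upwards [hapos] with t ht htm
    exact ht ⟨by linarith [htm.1], by linarith [htm.2]⟩
  have hφR : 0 ≤ φ (R / δ) - φ (-(R / δ)) := by
    have h0 : 0 ≤ R / δ := by positivity
    have := hφm.monotone (show -(R / δ) ≤ R / δ by linarith)
    linarith
  refine ⟨(φ (R / δ) - φ (-(R / δ)) + 1) / ∫ t in x + δ..y - δ, a t, by positivity, ?_⟩
  intro U Q h hU hUR
  have hα : 0 ≤ (φ (R / δ) - φ (-(R / δ)) + 1) / ∫ t in x + δ..y - δ, a t := by positivity
  have hQ := h.antitoneOn_momentum ha hG hGn hlam hα hapos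
  have h1 := momentum_le_of_antitoneOn h.hasDerivAt hψm hφψ hφm hδ0 (by linarith) hQ
    (fun t _ => hU t) hUR
  have h2 := le_momentum_of_antitoneOn h.hasDerivAt hψm hφψ hφm hδ0 (by linarith) hQ
    (fun t _ => hU t) hUR
  have h3 := h.integral_add_le_momentum_sub ha hG hα (t₁ := x + δ) (t₂ := y - δ) (by linarith)
  have h4 := mul_nonneg hlam.le (integral_nonneg_of_mem_Icc hapos (fun t => hGn (U t))
    (t₁ := x + δ) (t₂ := y - δ) ⟨by linarith, by linarith⟩ ⟨by linarith, by linarith⟩ (by linarith))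
  rw [div_mul_cancel₀ _ hI.ne'] at h3
  linarith

theorem statement15
    (T : ℝ) (hT : 0 < T)
    (φ : ℝ → ℝ) (hφc : Continuous φ) (hφm : StrictMono φ)
    (hφs : Function.Surjective φ) (hφ0 : φ 0 = 0)
    -- upper σ-condition at zero
    (hφσ : ∀ c : ℝ, 1 < |c| → ∃ C : ℝ,
      ∀ᶠ s in nhdsWithin 0 (Set.Ioi (0:ℝ)), |φ (c * s)| / φ s ≤ C)
    -- lower σ-condition at infinity
    (hφσinf : ∀ c : ℝ, 1 < c →
      (∃ C : ℝ, ∀ᶠ s in Filter.atTop, φ (c * s) / φ s ≤ C) ∧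
      (∃ C : ℝ, ∀ᶠ s in Filter.atBot, φ (c * s) / φ s ≤ C))
    (a : ℝ → ℝ) (haloc : LocallyIntegrable a volume)
    (haper : Function.Periodic a T)
    (haneg : (∫ t in (0:ℝ)..T, a t) < 0)
    (N : ℕ) (σ τ : Fin (N + 1) → ℝ) (hstar : SignChanging T a N σ τ)
    (g : ℝ → ℝ) (hgc : ContinuousOn g (Set.Ici 0))
    (hg0 : g 0 = 0) (hgpos : ∀ s : ℝ, 0 < s → 0 < g s)
    (hreg : RegOscZero g)
    (hgφ : Tendsto (fun s => g s / φ s) (nhdsWithin 0 (Set.Ioi 0)) (nhds 0))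
    (hgφinf : Tendsto (fun s => g |s| / |φ s|) Filter.atTop Filter.atTop ∧
      Tendsto (fun s => g |s| / |φ s|) Filter.atBot Filter.atTop) :
    ∀ lam : ℝ, 0 < lam →
      ∃ u : ℝ → ℝ,
        IsPhiLapSol T φ (fun t x => -(lam * a t * g x)) u ∧ ∀ t, 0 < u t := by
  intro lam hlam
  have hφpos : ∀ s, 0 < s → 0 < φ s := fun s hs => by rw [← hφ0]; exact hφm hs
  have hφneg : ∀ s, 0 < s → 0 < -φ (-s) := fun s hs => by
    rw [neg_pos, ← hφ0]; exact hφm (neg_neg_of_pos hs)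
  obtain ⟨ψ, hψc, hψm, hφψ, hψφ⟩ : ∃ ψ : ℝ → ℝ, Continuous ψ ∧ StrictMono ψ ∧
      (∀ s, φ (ψ s) = s) ∧ ∀ s, ψ (φ s) = s := by
    set e := hφm.orderIsoOfSurjective φ hφs
    exact ⟨e.symm, e.symm.continuous, e.symm.strictMono, e.apply_symm_apply, e.symm_apply_apply⟩
  have hψ0 : ψ 0 = 0 := by rw [← hφ0, hψφ, hφ0]
  have ha : ∀ x y, IntervalIntegrable a volume x y := fun x y =>
    (haloc.integrableOn_isCompact isCompact_uIcc).intervalIntegrable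
  have hb₁ : ∀ x y, IntervalIntegrable (fun t => lam * a t) volume x y := fun x y =>
    (ha x y).const_mul lam
  have hb₂ : ∀ x y, IntervalIntegrable (fun t => max (a t) 0) volume x y := fun x y =>
    ⟨(ha x y).1.pos_part, (ha x y).2.pos_part⟩
  have hper₁ : Function.Periodic (fun t => lam * a t) T := fun t => by simp only [haper t]
  have hper₂ : Function.Periodic (fun t => max (a t) 0) T := fun t => by simp only [haper t]
  have hneg : ∫ t in (0 : ℝ)..T, lam * a t < 0 := by
    rw [intervalIntegral.integral_const_mul]
    exact mul_neg_of_pos_of_neg hlam haneg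
  have hK : 0 < ∫ t in (0 : ℝ)..T, |lam * a t| :=
    (abs_pos.2 hneg.ne).trans_le (intervalIntegral.abs_integral_le_integral_abs hT.le)
  have hσ0 : ∀ c : ℝ, 1 < c → ∃ C : ℝ, ∀ᶠ s in nhdsWithin 0 (Ioi (0 : ℝ)),
      φ (c * s) ≤ C * φ s := fun c hc => by
    obtain ⟨C, hC⟩ := hφσ c (hc.trans_le (le_abs_self c))
    refine ⟨C, ?_⟩
    filter_upwards [hC, self_mem_nhdsWithin] with s hs hs0
    rw [div_le_iff₀ (hφpos s hs0)] at hs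
    exact (le_abs_self _).trans hs
  have hσtop : ∀ c : ℝ, 1 < c → ∃ C : ℝ, ∀ᶠ s in atTop, φ (c * s) ≤ C * φ s := fun c hc => by
    obtain ⟨C, hC⟩ := (hφσinf c hc).1
    refine ⟨C, ?_⟩
    filter_upwards [hC, eventually_gt_atTop 0] with s hs hs0
    rwa [div_le_iff₀ (hφpos s hs0)] at hs
  have hσbot : ∀ c : ℝ, 1 < c → ∃ C : ℝ, ∀ᶠ s in atTop, -φ (-(c * s)) ≤ C * -φ (-s) :=
    fun c hc => by
    obtain ⟨C, hC⟩ := (hφσinf c hc).2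
    refine ⟨C, ?_⟩
    filter_upwards [tendsto_neg_atTop_atBot.eventually hC, eventually_gt_atTop 0] with s hs hs0
    rwa [mul_neg, ← neg_div_neg_eq, div_le_iff₀ (hφneg s hs0)] at hs
  set gh : ℝ → ℝ := fun x => g (max 0 x) with hgh
  have hghc : Continuous gh :=
    hgc.comp_continuous (by fun_prop) fun x => le_max_left 0 x
  have hgh_eq : ∀ x, 0 ≤ x → gh x = g x := fun x hx => by simp only [hgh, max_eq_right hx]
  have hgh0 : ∀ x ≤ 0, gh x = 0 := fun x hx => by simp only [hgh, max_eq_left hx, hg0]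
  have hghpos : ∀ x, 0 < x → 0 < gh x := fun x hx => by rw [hgh_eq x hx.le]; exact hgpos x hx
  have hghn : ∀ x, 0 ≤ gh x := fun x => by
    rcases le_or_gt x 0 with hx | hx
    · exact (hgh0 x hx).ge
    · exact (hghpos x hx).le
  have hgh_small : ∀ e : ℝ, 0 < e → ∀ᶠ s in nhdsWithin 0 (Ioi (0 : ℝ)), gh s ≤ e * φ s :=
    fun e he => by
    filter_upwards [hgφ.eventually_lt_const he, self_mem_nhdsWithin] with s hs hs0
    rw [div_lt_iff₀ (hφpos s hs0)] at hs
    rw [hgh_eq s (le_of_lt hs0)]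
    exact hs.le
  have hg_top : ∀ K : ℝ, ∀ᶠ s in atTop, K * φ s ≤ gh s := fun K => by
    filter_upwards [hgφinf.1.eventually_ge_atTop K, eventually_gt_atTop 0] with s hs hs0
    rwa [abs_of_pos hs0, abs_of_pos (hφpos s hs0), le_div_iff₀ (hφpos s hs0),
      ← hgh_eq s hs0.le] at hs
  have hg_bot : ∀ K : ℝ, ∀ᶠ s in atTop, K * -φ (-s) ≤ gh s := fun K => by
    filter_upwards [tendsto_neg_atTop_atBot.eventually (hgφinf.2.eventually_ge_atTop K),
      eventually_gt_atTop 0] with s hs hs0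
    rwa [abs_neg, abs_of_pos hs0, abs_of_neg (neg_pos.1 (hφneg s hs0)),
      le_div_iff₀ (hφneg s hs0), ← hgh_eq s hs0.le] at hs
  have hosc : ∀ δ > 0, ∃ η > 0, ∃ s₀ > 0, ∀ ω s, |ω - 1| < η → 0 < s → s < s₀ →
      |gh (ω * s) - gh s| ≤ δ * gh s := fun δ hδ => by
    obtain ⟨η, hη, s₀, hs₀, h⟩ := hreg.exists_abs_sub_le hgpos hδ
    refine ⟨min η 1, by positivity, s₀, hs₀, fun ω s hω hs hss => ?_⟩
    have hω0 : 0 < ω := by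
      have := (abs_lt.1 (hω.trans_le (min_le_right _ _))).1
      linarith
    rw [hgh_eq _ (mul_pos hω0 hs).le, hgh_eq s hs.le]
    exact h ω s (hω.trans_le (min_le_left _ _)) hs hss
  have hsm : ∀ ε > 0, ∃ r₀ > 0, ∀ r, 0 < r → r ≤ r₀ → ∀ s ∈ Icc 0 r,
      (∫ t in (0 : ℝ)..T, |lam * a t|) * gh s ≤ φ (ε * r) := fun ε hε =>
    exists_forall_mul_le_of_small hφm hφ0 hσ0 (hgh0 0 le_rfl) hgh_small hK hε
  obtain ⟨r₁, hr₁, hr₁'⟩ := IsPeriodicSol.exists_forall_lt_of_small (b₂ := fun t => max (a t) 0) hT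
    hb₁ hper₁ hneg hψm hψ0 hψφ hghpos hosc hsm
  obtain ⟨r₂, hr₂, hr₂'⟩ := hsm (1 / (2 * T)) (by positivity)
  set r := min r₁ r₂ with hrdef
  have hr : 0 < r := lt_min hr₁ hr₂
  choose Rn hRn using fun n => exists_bound_of_max_mem hφm hψm hφ0 hψ0 hφψ hσtop hσbot hghc hg_top
    hg_bot ha hlam (hstar.1 n) (hstar.2.2.2.1 n)
  obtain ⟨R₁, hR₁⟩ := Finite.exists_le Rn
  set R := max R₁ (r + 1) with hRdef
  have hrR : r < R := (lt_add_one r).trans_le (le_max_right _ _)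
  set G : ℝ → ℝ := fun x => gh (min x R) with hGdef
  have hG : Continuous G := hghc.comp (by fun_prop)
  have hGn : ∀ x, 0 ≤ G x := fun x => hghn _
  have hG_eq : ∀ x ≤ R, G x = gh x := fun x hx => by simp only [hGdef, min_eq_left hx]
  have hG0 : ∀ x ≤ 0, G x = 0 := fun x hx => hgh0 _ ((min_le_left _ _).trans hx)
  obtain ⟨BG, hBG⟩ : ∃ B, ∀ x, |G x| ≤ B := by
    obtain ⟨B, hB⟩ := (isCompact_Icc (a := 0) (b := R)).exists_bound_of_continuousOn
      hghc.continuousOn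
    refine ⟨B, fun x => ?_⟩
    rcases le_total x 0 with hx | hx
    · rw [hG0 x hx, ← hgh0 0 le_rfl]
      exact hB 0 ⟨le_rfl, (hr.trans hrR).le⟩
    · exact hB _ ⟨le_min hx (hr.trans hrR).le, min_le_right _ _⟩
  obtain ⟨αmax, hαmax, hnone⟩ := exists_forcing_of_bound hφm hψm hφψ ha hG hGn hlam
    (hstar.1 0) (hr.trans hrR).le (hstar.2.2.2.1 0)
  have hnonneg : ∀ ϑ α U Q, 0 < ϑ → 0 ≤ α →
      IsPeriodicSol T ψ (auxRhs (fun t => lam * a t) (fun t => max (a t) 0) G ϑ α) U Q →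
      ∀ t, 0 ≤ U t := fun ϑ α U Q hϑ hα h =>
    h.nonneg hT hψm hψ0 hG0 (fun t => le_max_right _ _) hϑ hα
  obtain ⟨U, Q, h, hUR, hUr⟩ := exists_isPeriodicSol_of_apriori (p := 0) hT hψc hψm hψ0 hb₁ hb₂
    hper₁ hper₂ (by simpa using hneg) hG hG0 hBG hr hrR
    (by rw [hG_eq r hrR.le]; exact hghpos r hr) hαmax hnonneg
    (fun α U Q hα h hUR t => by
      by_contra hlt
      have hU := hnonneg 1 α U Q one_pos hα h
      obtain ⟨t₀, ht₀, hmax⟩ := h.exists_forall_ge_mem hT hψm hψ0 (p := σ 0)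
        (isClosed_iUnion_of_finite fun n => isClosed_Icc (a := σ n) (b := τ n))
        (mem_iUnion.2 ⟨0, left_mem_Icc.2 (hstar.1 0).le⟩) (by
          filter_upwards [hstar.2.2.2.2] with s hs hsm
          have h1 := hs hsm
          rw [auxRhs, max_eq_right h1, min_eq_right (by linarith [hU s]),
            max_eq_left (by linarith [hU s]), mul_zero, add_zero, add_zero, one_mul]
          exact mul_nonpos_of_nonpos_of_nonneg (mul_nonpos_of_nonneg_of_nonpos hlam.le h1)
            (hGn _))
      obtain ⟨n, hn⟩ := mem_iUnion.1 ht₀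
      refine hRn n R ((hR₁ n).trans (le_max_left _ _)) U Q h.hasDerivAt
        (h.antitoneOn_momentum ha hG hGn hlam hα (hstar.2.2.2.1 n)) hUR (fun t _ => hU t)
        (fun t₁ h₁ t₂ h₂ h₁₂ => ?_) t₀ hn (le_antisymm (hUR t₀) ((not_lt.1 hlt).trans (hmax t)))
      have h1 := h.integral_add_le_momentum_sub ha hG hα h₁₂
      have h2 := mul_nonneg hα (integral_nonneg_of_mem_Icc (hstar.2.2.2.1 n)
        (fun _ => zero_le_one) h₁ h₂ h₁₂)
      simp only [mul_one] at h2
      simp only [hG_eq _ (hUR _)] at h1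
      linarith)
    (fun U Q h hUR => hnone U Q h (hnonneg 1 αmax U Q one_pos hαmax h) hUR)
    (fun ϑ U Q hϑ hϑ1 h => hr₁' r hr (min_le_left _ _) G hGn
      (fun x hx => hG_eq x (hx.trans hrR.le)) ϑ U Q hϑ hϑ1 h (hnonneg ϑ 0 U Q hϑ le_rfl h))
  have hpos : ∀ t, 0 < U t := h.pos_of_not_small hT hb₁ hper₁ hK hψm hψ0 hψφ hGn hr
    (fun s hs => by
      rw [hG_eq s (hs.2.trans hrR.le)]
      exact hr₂' r hr (min_le_right _ _) s hs)
    (hnonneg 1 0 U Q one_pos le_rfl h) hUr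
  have hrhs : ∀ t, auxRhs (fun t => lam * a t) (fun t => max (a t) 0) G 1 0 t (U t) =
      lam * a t * g (U t) := fun t => by
    rw [auxRhs, hG_eq _ (hUR t), hgh_eq _ (hpos t).le, min_eq_right (by linarith [hpos t]),
      max_eq_left (by linarith [hpos t]), zero_mul, add_zero, add_zero, one_mul]
  have hint := h.intervalIntegrable
  have hsub := h.sub_eq
  simp only [hrhs] at hint hsub
  have hQ : Continuous Q := by
    have h1 : Q = fun t => Q 0 + -∫ s in (0 : ℝ)..t, lam * a s * g (U s) :=
      funext fun t => by rw [← hsub]; ring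
    rw [h1]
    exact continuous_const.add (intervalIntegral.continuous_primitive hint 0).neg
  refine ⟨U, ⟨h.periodic, fun t => ψ (Q t), hψc.comp hQ, h.hasDerivAt,
    fun t₁ t₂ => (hint t₁ t₂).neg, fun t => ?_⟩, hpos⟩
  rw [hφψ, hφψ, intervalIntegral.integral_neg, ← hsub]
  ring
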